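/- arXiv:math/0608747 — 4 statements merged into one kernel-verified Lean document; each statement's English description precedes it below -/
import Mathlib

section
/- Let K be a field of characteristic zero (e.g. K = ℚ), let k, n ∈ ℕ with 0 < k ≤ n, and let c be an n×n matrix over K. Then σ_k(c) = Σ_{ν ⊢ k} (−1)^{k−#ν} · (1/c(ν)) · ∏_{j=1}^{#ν} tr(c^{ν_j}), where the sum ranges over all partitions ν = (ν_1,…,ν_l) of k (so ν_1 ≥ ⋯ ≥ ν_l > 0 and ν_1 + ⋯ + ν_l = k), #ν = l denotes the number of parts, and c(ν) = ν_1 ⋯ ν_l · ∏_{r > 0} #{1 ≤ i ≤ l | ν_i = r}!. -/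
open scoped BigOperators

/-- `σ_k(X)`: the coefficient in the characteristic polynomial defined by
`det(λE − X) = λ^n − σ_1(X)λ^{n−1} + ⋯ + (−1)^n σ_n(X)`,
i.e. `σ_k(X) = (−1)^k · (coefficient of λ^{n−k} in det(λE − X))`. -/
noncomputable def sigmaCoeff {A : Type*} [CommRing A] (N : ℕ)
    (M : Matrix (Fin N) (Fin N) A) (k : ℕ) : A :=
  (-1) ^ k * (Matrix.charpoly M).coeff (N - k)

/-- `c(ν) = ν_1⋯ν_l · ∏_{r>0} #{i | ν_i = r}!` for a partition (multiset) `ν`. -/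
def cPart (m : Multiset ℕ) : ℕ :=
  m.prod * ∏ r ∈ m.toFinset, (m.count r).factorial


open Polynomial in
lemma aux_derivative_det {R : Type*} [CommRing R] {n : ℕ} (M : Matrix (Fin n) (Fin n) R[X]) :
    derivative M.det = ∑ i, (M.updateCol i (fun j => derivative (M j i))).det := by
  simp_rw [Matrix.det_apply]
  rw [Finset.sum_comm, derivative_sum]
  refine Finset.sum_congr rfl fun σ _ => ?_
  rw [← Finset.smul_sum, Units.smul_def, Units.smul_def, derivative_smul,
    derivative_prod_finset]
  congr 1
  refine Finset.sum_congr rfl fun i _ => ?_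
  rw [← Finset.prod_erase_mul _ _ (Finset.mem_univ i)]
  congr 1
  · refine Finset.prod_congr rfl fun j hj => ?_
    rw [Matrix.updateCol_ne (Finset.ne_of_mem_erase hj)]
  · simp

open Polynomial in
lemma aux_trace_adjugate {R : Type*} [CommRing R] {n : ℕ} (M : Matrix (Fin n) (Fin n) R) :
    (M.charmatrix.adjugate).trace = derivative M.charpoly := by
  rw [← Matrix.charpoly_transpose, Matrix.charpoly, aux_derivative_det, Matrix.trace]
  refine Finset.sum_congr rfl fun i _ => ?_
  rw [Matrix.diag_apply, Matrix.adjugate_apply, Matrix.charmatrix_transpose,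
    ← Matrix.det_transpose, ← Matrix.updateCol_transpose]
  congr 2
  funext j
  by_cases h : i = j
  · subst h; simp
  · rw [Matrix.transpose_apply, Matrix.charmatrix_apply_ne _ _ _ h]
    simp [Ne.symm h]

open Polynomial in
lemma aux_coeff_rec {R : Type*} [CommRing R] {n : ℕ} (M : Matrix (Fin n) (Fin n) R) (m : ℕ) :
    (matPolyEquiv M.charmatrix.adjugate).coeff m =
      M * (matPolyEquiv M.charmatrix.adjugate).coeff (m + 1)
        + M.charpoly.coeff (m + 1) • (1 : Matrix (Fin n) (Fin n) R) := by
  have h := congrArg matPolyEquiv (Matrix.mul_adjugate M.charmatrix)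
  rw [map_mul, Matrix.matPolyEquiv_charmatrix] at h
  have h2 := congrArg (fun p => p.coeff (m + 1)) h
  simp only [sub_mul, coeff_sub, coeff_X_mul, coeff_C_mul] at h2
  change _ = (matPolyEquiv (M.charpoly • 1)).coeff (m + 1) at h2
  rw [matPolyEquiv_smul_one, coeff_map, Algebra.algebraMap_eq_smul_one] at h2
  rw [← h2]; abel

open Polynomial in
lemma aux_trace_sum {R : Type*} [CommRing R] {n : ℕ} (M : Matrix (Fin n) (Fin n) R) (m l : ℕ) :
    ((matPolyEquiv M.charmatrix.adjugate).coeff m).trace =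
      (M ^ l * (matPolyEquiv M.charmatrix.adjugate).coeff (m + l)).trace
        + ∑ j ∈ Finset.range l, M.charpoly.coeff (m + 1 + j) * (M ^ j).trace := by
  induction l with
  | zero => simp
  | succ l ih =>
    rw [ih, Finset.sum_range_succ, aux_coeff_rec M (m + l), mul_add, Matrix.trace_add,
      ← mul_assoc, ← pow_succ, mul_smul_comm, mul_one, Matrix.trace_smul, smul_eq_mul,
      show m + l + 1 = m + 1 + l by ring, show m + (l + 1) = m + 1 + l by ring]
    ring

open Polynomial in
lemma aux_newton_coeff {R : Type*} [CommRing R] {n : ℕ} (M : Matrix (Fin n) (Fin n) R) (m l : ℕ)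
    (hl : n ≤ m + l) :
    M.charpoly.coeff (m + 1) * (m + 1) =
      ∑ j ∈ Finset.range l, M.charpoly.coeff (m + 1 + j) * (M ^ j).trace := by
  have h0 : ∀ i, (matPolyEquiv M.charmatrix.adjugate).coeff (m + l) =
      M ^ i * (matPolyEquiv M.charmatrix.adjugate).coeff (m + l + i) := by
    intro i
    induction i with
    | zero => simp
    | succ i ih =>
      nontriviality R
      rw [ih, aux_coeff_rec M (m + l + i),
        coeff_eq_zero_of_natDegree_lt (p := M.charpoly)]
      · simp [pow_succ, mul_assoc, add_assoc]
      · rw [Matrix.charpoly_natDegree_eq_dim, Fintype.card_fin]; omega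
  have h1 : (matPolyEquiv M.charmatrix.adjugate).coeff (m + l) = 0 := by
    rw [h0 ((matPolyEquiv M.charmatrix.adjugate).natDegree + 1), coeff_eq_zero_of_natDegree_lt,
      mul_zero]
    omega
  have h2 := aux_trace_sum M m l
  rw [h1, mul_zero, Matrix.trace_zero, zero_add] at h2
  rw [← h2, ← coeff_derivative, ← aux_trace_adjugate]
  simp [Matrix.trace, matPolyEquiv_coeff_apply]

lemma aux_newton {R : Type*} [CommRing R] {n : ℕ} (M : Matrix (Fin n) (Fin n) R) (k : ℕ)
    (hk : k ≤ n) :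
    (k : R) * sigmaCoeff n M k =
      ∑ r ∈ Finset.Icc 1 k, ((-1) ^ (r + 1) * (M ^ r).trace) * sigmaCoeff n M (k - r) := by
  nontriviality R
  have key : M.charpoly.coeff (n - k) * ((n - k : ℕ) : R) =
      ∑ j ∈ Finset.range (k + 1), M.charpoly.coeff (n - k + j) * (M ^ j).trace := by
    rcases Nat.eq_zero_or_pos (n - k) with h | h
    · have hkn : k = n := by omega
      subst hkn
      have := congrArg Matrix.trace (Matrix.aeval_self_charpoly M)
      rw [Polynomial.aeval_eq_sum_range, Matrix.charpoly_natDegree_eq_dim, Fintype.card_fin,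
        Matrix.trace_sum] at this
      simp only [Matrix.trace_smul, smul_eq_mul, Matrix.trace_zero] at this
      simp [this]
    · obtain ⟨m, hm⟩ : ∃ m, n - k = m + 1 := ⟨n - k - 1, by omega⟩
      have := aux_newton_coeff M m (k + 1) (by omega)
      rw [hm]; push_cast; exact this
  rw [Finset.sum_range_succ', Nat.cast_sub hk] at key
  simp only [add_zero, pow_zero, Matrix.trace_one, Fintype.card_fin] at key
  have key2 : (k : R) * M.charpoly.coeff (n - k) =
      - ∑ j ∈ Finset.range k, M.charpoly.coeff (n - k + (j + 1)) * (M ^ (j + 1)).trace := by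
    linear_combination -key
  rw [← Finset.sum_bij (i := fun j _ => j + 1) (s := Finset.range k) (t := Finset.Icc 1 k)
    (f := fun j => ((-1) ^ (j + 1 + 1) * (M ^ (j + 1)).trace) * sigmaCoeff n M (k - (j + 1)))
    (g := fun r => ((-1) ^ (r + 1) * (M ^ r).trace) * sigmaCoeff n M (k - r))]
  · unfold sigmaCoeff
    rw [mul_left_comm, key2, mul_neg, Finset.mul_sum, ← Finset.sum_neg_distrib]
    refine Finset.sum_congr rfl fun j hj => ?_
    have hj := Finset.mem_range.1 hj
    rw [show n - (k - (j + 1)) = n - k + (j + 1) by omega]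
    have : (-1 : R) ^ k = (-1) ^ (j + 1) * (-1) ^ (k - (j + 1)) := by
      rw [← pow_add]; congr 1; omega
    rw [this]; ring
  · intro a ha; simp at ha ⊢; omega
  · intro a _ b _ h; simpa using h
  · intro b hb
    simp at hb
    exact ⟨b - 1, by simp; omega, by omega⟩
  · intros; rfl

lemma aux_cPart_cons (r : ℕ) (m : Multiset ℕ) :
    cPart (r ::ₘ m) = r * (m.count r + 1) * cPart m := by
  unfold cPart
  have h1 : ∏ s ∈ m.toFinset, (m.count s).factorial =
      ∏ s ∈ insert r m.toFinset, (m.count s).factorial := by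
    refine Finset.prod_subset (Finset.subset_insert _ _) fun x _ hx => ?_
    rw [Multiset.count_eq_zero_of_notMem (by simpa using hx), Nat.factorial_zero]
  rw [h1, Multiset.toFinset_cons, Multiset.prod_cons,
    ← Finset.mul_prod_erase _ _ (Finset.mem_insert_self r _),
    ← Finset.mul_prod_erase _ (fun s => (m.count s).factorial) (Finset.mem_insert_self r _),
    Multiset.count_cons_self, Nat.factorial_succ]
  have h2 : ∏ x ∈ (insert r m.toFinset).erase r, ((r ::ₘ m).count x).factorial =
      ∏ x ∈ (insert r m.toFinset).erase r, (m.count x).factorial := by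
    refine Finset.prod_congr rfl fun x hx => ?_
    rw [Multiset.count_cons_of_ne (Finset.ne_of_mem_erase hx)]
  rw [h2]; ring

/-- weight of a multiset -/
noncomputable def auxW {K : Type*} [Field K] (q : ℕ → K) (m : Multiset ℕ) : K :=
  (cPart m : K)⁻¹ * (m.map q).prod

lemma auxW_cons {K : Type*} [Field K] [CharZero K] (q : ℕ → K) (m : Multiset ℕ) (r : ℕ)
    (hr : 0 < r) :
    ((r * (r ::ₘ m).count r : ℕ) : K) * auxW q (r ::ₘ m) = q r * auxW q m := by
  unfold auxW
  rw [aux_cPart_cons, Multiset.map_cons, Multiset.prod_cons, Multiset.count_cons_self,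
    Nat.cast_mul (r * (m.count r + 1)), mul_inv]
  have : ((r * (m.count r + 1) : ℕ) : K) ≠ 0 := by
    exact_mod_cast Nat.mul_ne_zero hr.ne' (Nat.succ_ne_zero _)
  field_simp

lemma auxW_rec {K : Type*} [Field K] [CharZero K] (q : ℕ → K) (k : ℕ) :
    (k : K) * ∑ ν : Nat.Partition k, auxW q ν.parts =
      ∑ r ∈ Finset.Icc 1 k, q r * ∑ μ : Nat.Partition (k - r), auxW q μ.parts := by
  have h1 : ∀ ν : Nat.Partition k, (k : K) * auxW q ν.parts =
      ∑ r ∈ ν.parts.toFinset, ((r * ν.parts.count r : ℕ) : K) * auxW q ν.parts := by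
    intro ν
    rw [← Finset.sum_mul, ← Nat.cast_sum]
    congr 2
    conv_lhs => rw [← ν.parts_sum, Finset.sum_multiset_count]
    refine Finset.sum_congr rfl fun r _ => ?_
    rw [smul_eq_mul, mul_comm]
  rw [Finset.mul_sum, Finset.sum_congr rfl fun ν _ => h1 ν, Finset.sum_sigma']
  simp_rw [Finset.mul_sum]
  rw [Finset.sum_sigma']
  symm
  refine Finset.sum_bij
    (i := fun (x : Σ r : ℕ, Nat.Partition (k - r)) hx =>
      (⟨⟨x.1 ::ₘ x.2.parts, ?_, ?_⟩, x.1⟩ : Σ _ : Nat.Partition k, ℕ)) ?_ ?_ ?_ ?_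
  · intro i hi
    simp only [Finset.mem_sigma, Finset.mem_Icc] at hx
    rcases Multiset.mem_cons.1 hi with h | h
    · omega
    · exact x.2.parts_pos h
  · simp only [Finset.mem_sigma, Finset.mem_Icc] at hx
    rw [Multiset.sum_cons, x.2.parts_sum]; omega
  · intro x hx
    simp
  · rintro ⟨r, μ⟩ _ ⟨s, μ'⟩ _ h
    simp only [Sigma.mk.injEq, Nat.Partition.mk.injEq, heq_eq_eq] at h
    obtain ⟨h, rfl⟩ := h
    rw [Multiset.cons_inj_right] at h
    rw [Nat.Partition.ext h]
  · rintro ⟨ν, r⟩ h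
    simp only [Finset.mem_sigma, Finset.mem_univ, true_and, Multiset.mem_toFinset] at h
    have hs : (ν.parts.erase r).sum = k - r := by
      have := Multiset.sum_erase h
      rw [ν.parts_sum] at this; omega
    refine ⟨⟨r, ⟨ν.parts.erase r, fun hi => ν.parts_pos (Multiset.mem_of_mem_erase hi), hs⟩⟩,
      ?_, ?_⟩
    · simp only [Finset.mem_sigma, Finset.mem_Icc, Finset.mem_univ, and_true]
      exact ⟨ν.parts_pos h, Nat.Partition.le_of_mem_parts h⟩
    · simp only [Sigma.mk.injEq, heq_eq_eq, and_true]
      exact Nat.Partition.ext (Multiset.cons_erase h)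
  · intro x hx
    simp only [Finset.mem_sigma, Finset.mem_Icc] at hx
    exact (auxW_cons q x.2.parts x.1 (by omega)).symm

lemma aux_sign {K : Type*} [Field K] (p : ℕ → K) (m : Multiset ℕ) :
    (m.map fun j => (-1) ^ (j + 1) * p j).prod =
      (-1) ^ (m.sum + Multiset.card m) * (m.map p).prod := by
  induction m using Multiset.induction_on with
  | empty => simp
  | cons a m ih =>
    simp only [Multiset.map_cons, Multiset.prod_cons, Multiset.sum_cons, Multiset.card_cons, ih]
    ring

lemma aux_main {K : Type*} [Field K] [CharZero K] (n : ℕ) (c : Matrix (Fin n) (Fin n) K)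
    (k : ℕ) : k ≤ n → sigmaCoeff n c k = ∑ ν : Nat.Partition k,
      auxW (fun j => (-1) ^ (j + 1) * (c ^ j).trace) ν.parts := by
  induction k using Nat.strong_induction_on with
  | _ k ih =>
    intro hk
    rcases Nat.eq_zero_or_pos k with rfl | hpos
    · have h := c.charpoly_monic.coeff_natDegree
      rw [Matrix.charpoly_natDegree_eq_dim, Fintype.card_fin] at h
      simp [sigmaCoeff, h, auxW, cPart]
    · have hk0 : (k : K) ≠ 0 := by exact_mod_cast hpos.ne'
      apply mul_left_cancel₀ hk0
      rw [aux_newton c k hk, auxW_rec]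
      refine Finset.sum_congr rfl fun r hr => ?_
      have hr := Finset.mem_Icc.1 hr
      rw [ih (k - r) (by omega) (by omega)]

theorem stmt3 (K : Type*) [Field K] [CharZero K] (k n : ℕ) (hk : 0 < k) (hkn : k ≤ n)
    (c : Matrix (Fin n) (Fin n) K) :
    sigmaCoeff n c k = ∑ ν : Nat.Partition k,
      (-1 : K) ^ (k - Multiset.card ν.parts) * (cPart ν.parts : K)⁻¹ *
        (ν.parts.map fun j => Matrix.trace (c ^ j)).prod := by
  rw [aux_main n c k hkn]
  refine Finset.sum_congr rfl fun ν _ => ?_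
  have hcard : Multiset.card ν.parts ≤ k := by
    have h := Multiset.card_nsmul_le_sum (s := ν.parts) (a := 1) (fun x hx => ν.parts_pos hx)
    rw [ν.parts_sum] at h
    simpa using h
  rw [auxW, aux_sign, ν.parts_sum]
  have : (-1 : K) ^ (k + Multiset.card ν.parts) = (-1) ^ (k - Multiset.card ν.parts) := by
    generalize Multiset.card ν.parts = l at hcard ⊢
    obtain ⟨d, rfl⟩ := Nat.exists_eq_add_of_le hcard
    rw [Nat.add_sub_cancel_left, show l + d + l = 2 * l + d by ring, pow_add, pow_mul]
    simp
  rw [this]; ring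
end

section
/- Let Y and Z be 4×4 matrices over a commutative unital ring. Then P(Y) · P(Z) = σ_2(YZ) + σ_2(YZ^t) − tr(YZ)·tr(YZ^t) + tr(YZYZ^t) + tr(YZY^tZ) − tr(YZY^tZ^t). -/
open scoped BigOperators

/-- The condition on a permutation `π` appearing in the definition of the pfaffian:
`π(1) < π(3) < ⋯ < π(N−1)` and `π(2i−1) < π(2i)` (written 0-based). -/
def pfCond {N : ℕ} (π : Equiv.Perm (Fin N)) : Prop :=
  (∀ i : ℕ, ∀ h : 2 * i + 1 < N, π ⟨2 * i, by omega⟩ < π ⟨2 * i + 1, h⟩) ∧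
  (∀ i j : ℕ, ∀ _hij : i < j, ∀ h : 2 * j < N, π ⟨2 * i, by omega⟩ < π ⟨2 * j, h⟩)

/-- `∏_{i=1}^{N/2} x_{π(2i−1), π(2i)}` (written 0-based). -/
def pairProd {A : Type*} [CommRing A] {N : ℕ} (X : Matrix (Fin N) (Fin N) A)
    (π : Equiv.Perm (Fin N)) : A :=
  ∏ i ∈ Finset.range (N / 2),
    if h : 2 * i + 1 < N then X (π ⟨2 * i, by omega⟩) (π ⟨2 * i + 1, h⟩) else 0

open scoped Classical in
/-- The pfaffian of a (skew-symmetric) `N×N` matrix. -/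
noncomputable def pfaffian {A : Type*} [CommRing A] {N : ℕ} (X : Matrix (Fin N) (Fin N) A) : A :=
  ∑ π ∈ Finset.univ.filter pfCond, (Equiv.Perm.sign π : ℤ) • pairProd X π

/-- The generalized pfaffian `P(X) = pf(X − Xᵗ)` of an arbitrary `N×N` matrix. -/
noncomputable def genPf {A : Type*} [CommRing A] {N : ℕ} (X : Matrix (Fin N) (Fin N) A) : A :=
  pfaffian (X - X.transpose)

lemma pfCond_four (π : Equiv.Perm (Fin 4)) :
    pfCond π ↔ (π 0 < π 1 ∧ π 2 < π 3 ∧ π 0 < π 2) := by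
  constructor
  · rintro ⟨h1, h2⟩
    exact ⟨h1 0 (by omega), h1 1 (by omega), h2 0 1 (by omega) (by omega)⟩
  · rintro ⟨h1, h2, h3⟩
    refine ⟨fun i h => ?_, fun i j hij h => ?_⟩
    · have : i = 0 ∨ i = 1 := by omega
      rcases this with rfl | rfl
      · exact h1
      · exact h2
    · have hi : i = 0 := by omega
      have hj : j = 1 := by omega
      subst hi hj
      exact h3


lemma filter_four' : (Finset.univ.filter fun π : Equiv.Perm (Fin 4) =>
      (π 0 < π 1 ∧ π 2 < π 3 ∧ π 0 < π 2)) =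
    {1, Equiv.swap 1 2, Equiv.swap 1 2 * Equiv.swap 1 3} := by
  decide +kernel

lemma pairProd_four {A : Type*} [CommRing A] (X : Matrix (Fin 4) (Fin 4) A)
    (π : Equiv.Perm (Fin 4)) : pairProd X π = X (π 0) (π 1) * X (π 2) (π 3) := by
  simp [pairProd, Finset.prod_range_succ]

open scoped Classical in
lemma pfaffian_four {A : Type*} [CommRing A] (X : Matrix (Fin 4) (Fin 4) A) :
    pfaffian X = X 0 1 * X 2 3 - X 0 2 * X 1 3 + X 0 3 * X 1 2 := by
  have h : (Finset.univ.filter fun π : Equiv.Perm (Fin 4) => pfCond π) =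
      {1, Equiv.swap 1 2, Equiv.swap 1 2 * Equiv.swap 1 3} := by
    rw [← filter_four']
    ext π
    simp only [Finset.mem_filter, pfCond_four]
  have e1 : (1 : Equiv.Perm (Fin 4)) ∉
      ({Equiv.swap 1 2, Equiv.swap 1 2 * Equiv.swap 1 3} : Finset (Equiv.Perm (Fin 4))) := by
    decide +kernel
  have e2 : (Equiv.swap 1 2 : Equiv.Perm (Fin 4)) ∉
      ({Equiv.swap 1 2 * Equiv.swap 1 3} : Finset (Equiv.Perm (Fin 4))) := by
    decide +kernel
  have s1 : Equiv.Perm.sign (Equiv.swap 1 2 : Equiv.Perm (Fin 4)) = -1 := by decide +kernel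
  have s2 : Equiv.Perm.sign (Equiv.swap 1 2 * Equiv.swap 1 3 : Equiv.Perm (Fin 4)) = 1 := by
    decide +kernel
  have a0 : (Equiv.swap 1 2 : Equiv.Perm (Fin 4)) 0 = 0 := by decide
  have a1 : (Equiv.swap 1 2 : Equiv.Perm (Fin 4)) 1 = 2 := by decide
  have a2 : (Equiv.swap 1 2 : Equiv.Perm (Fin 4)) 2 = 1 := by decide
  have a3 : (Equiv.swap 1 2 : Equiv.Perm (Fin 4)) 3 = 3 := by decide
  have b0 : (Equiv.swap 1 2 * Equiv.swap 1 3 : Equiv.Perm (Fin 4)) 0 = 0 := by decide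
  have b1 : (Equiv.swap 1 2 * Equiv.swap 1 3 : Equiv.Perm (Fin 4)) 1 = 3 := by decide
  have b2 : (Equiv.swap 1 2 * Equiv.swap 1 3 : Equiv.Perm (Fin 4)) 2 = 1 := by decide
  have b3 : (Equiv.swap 1 2 * Equiv.swap 1 3 : Equiv.Perm (Fin 4)) 3 = 2 := by decide
  unfold pfaffian
  rw [h, Finset.sum_insert e1, Finset.sum_insert e2, Finset.sum_singleton, s1, s2]
  simp only [pairProd_four, a0, a1, a2, a3, b0, b1, b2, b3]
  simp
  ring

open Polynomial in
lemma sigma_four {A : Type*} [CommRing A] (M : Matrix (Fin 4) (Fin 4) A) :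
    sigmaCoeff 4 M 2 =
      (M 0 0 * M 1 1 - M 0 1 * M 1 0) + (M 0 0 * M 2 2 - M 0 2 * M 2 0)
      + (M 0 0 * M 3 3 - M 0 3 * M 3 0) + (M 1 1 * M 2 2 - M 1 2 * M 2 1)
      + (M 1 1 * M 3 3 - M 1 3 * M 3 1) + (M 2 2 * M 3 3 - M 2 3 * M 3 2) := by
  have key : ∃ a b d : A, M.charpoly = X ^ 4 + C a * X ^ 3 + C (
      (M 0 0 * M 1 1 - M 0 1 * M 1 0) + (M 0 0 * M 2 2 - M 0 2 * M 2 0)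
      + (M 0 0 * M 3 3 - M 0 3 * M 3 0) + (M 1 1 * M 2 2 - M 1 2 * M 2 1)
      + (M 1 1 * M 3 3 - M 1 3 * M 3 1) + (M 2 2 * M 3 3 - M 2 3 * M 3 2)) * X ^ 2
      + C b * X + C d := by
    refine ⟨-(M 0 0 + M 1 1 + M 2 2 + M 3 3),
      -((M 0 0 * (M 1 1 * M 2 2 - M 1 2 * M 2 1)
          - M 0 1 * (M 1 0 * M 2 2 - M 1 2 * M 2 0)
          + M 0 2 * (M 1 0 * M 2 1 - M 1 1 * M 2 0))
        + (M 0 0 * (M 1 1 * M 3 3 - M 1 3 * M 3 1)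
          - M 0 1 * (M 1 0 * M 3 3 - M 1 3 * M 3 0)
          + M 0 3 * (M 1 0 * M 3 1 - M 1 1 * M 3 0))
        + (M 0 0 * (M 2 2 * M 3 3 - M 2 3 * M 3 2)
          - M 0 2 * (M 2 0 * M 3 3 - M 2 3 * M 3 0)
          + M 0 3 * (M 2 0 * M 3 2 - M 2 2 * M 3 0))
        + (M 1 1 * (M 2 2 * M 3 3 - M 2 3 * M 3 2)
          - M 1 2 * (M 2 1 * M 3 3 - M 2 3 * M 3 1)
          + M 1 3 * (M 2 1 * M 3 2 - M 2 2 * M 3 1))),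
      M.det, ?_⟩
    simp [Matrix.charpoly, Matrix.charmatrix_apply, Matrix.det_succ_row_zero, Fin.sum_univ_succ,
      Fin.succAbove, Matrix.diagonal_apply]
    ring
  obtain ⟨a, b, d, h⟩ := key
  rw [sigmaCoeff, h]
  generalize (M 0 0 * M 1 1 - M 0 1 * M 1 0) + (M 0 0 * M 2 2 - M 0 2 * M 2 0)
      + (M 0 0 * M 3 3 - M 0 3 * M 3 0) + (M 1 1 * M 2 2 - M 1 2 * M 2 1)
      + (M 1 1 * M 3 3 - M 1 3 * M 3 1) + (M 2 2 * M 3 3 - M 2 3 * M 3 2) = e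
  simp [coeff_X, coeff_C, coeff_X_pow]

set_option maxHeartbeats 4000000 in
theorem stmt5 {A : Type*} [CommRing A] (Y Z : Matrix (Fin 4) (Fin 4) A) :
    genPf Y * genPf Z =
      sigmaCoeff 4 (Y * Z) 2 + sigmaCoeff 4 (Y * Z.transpose) 2
        - Matrix.trace (Y * Z) * Matrix.trace (Y * Z.transpose)
        + Matrix.trace (Y * Z * Y * Z.transpose)
        + Matrix.trace (Y * Z * Y.transpose * Z)
        - Matrix.trace (Y * Z * Y.transpose * Z.transpose) := by
  simp only [genPf, pfaffian_four, sigma_four, Matrix.trace, Matrix.diag_apply, Matrix.mul_apply,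
    Matrix.sub_apply, Matrix.transpose_apply, Fin.sum_univ_four]
  ring
end

section
/- (Amitsur's formula.) Let K be an infinite field, let n be a positive integer, let k_1 + ⋯ + k_s = n with each k_j a positive integer, and let X_1,…,X_s be n×n matrices over a commutative unital K-algebra. Then det_{k_1,…,k_s}(X_1,…,X_s) = Σ (−1)^{n + (i_1 + ⋯ + i_q)} σ_{i_1}(c_1) ⋯ σ_{i_q}(c_q), where the sum ranges over all equivalence classes (up to cyclic permutation of each word) of multisets {{c_1 repeated i_1 times, …, c_q repeated i_q times}} such that: (i) c_1,…,c_q are primitive words in the letters X_1,…,X_s that are pairwise different up to cyclic permutation; and (ii) i_1·deg_{X_j}(c_1) + ⋯ + i_q·deg_{X_j}(c_q) = k_j for every 1 ≤ j ≤ s. Here σ_i(c) is evaluated at the product of matrices given by the word c. -/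
open scoped BigOperators

/-- The partial linearization `det_{k_1,…,k_s}(X_1,…,X_s)`: the coefficient of
`x_1^{k_1}⋯x_s^{k_s}` in `det(x_1 X_1 + ⋯ + x_s X_s)`. -/
noncomputable def detLin {A : Type*} [CommRing A] {n s : ℕ} (k : Fin s → ℕ)
    (X : Fin s → Matrix (Fin n) (Fin n) A) : A :=
  MvPolynomial.coeff (Finsupp.equivFunOnFinite.symm k)
    (Matrix.det (Matrix.of fun i j =>
      ∑ r, (MvPolynomial.X r : MvPolynomial (Fin s) A) * MvPolynomial.C (X r i j)))

/-- A word in a free monoid is primitive if it is not a power (with at least two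
factors) of a shorter word. -/
def PrimitiveWord {α : Type*} (w : List α) : Prop :=
  w ≠ [] ∧ ∀ (u : List α) (r : ℕ), 2 ≤ r → w ≠ (List.replicate r u).flatten

/-- The condition on a multiset `M` of words indexing a summand in Amitsur's formula:
all member words are primitive, cyclically equivalent members are equal (so that the
distinct members are pairwise different with respect to cyclic permutation), and the
degree condition `Σ_w (multiplicity of w) · deg_{X_j}(w) = k_j` holds for all `j`. -/
def AmitsurIndex {s : ℕ} (k : Fin s → ℕ) (M : Multiset (List (Fin s))) : Prop :=
  (∀ w ∈ M, PrimitiveWord w) ∧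
  (∀ w ∈ M, ∀ w' ∈ M, w.IsRotated w' → w = w') ∧
  (∀ j : Fin s, (M.map fun w => w.count j).sum = k j)

section Words
variable {α : Type*}

/-- power of a word -/
def wpow (u : List α) (r : ℕ) : List α := (List.replicate r u).flatten

lemma wpow_zero (u : List α) : wpow u 0 = [] := by simp [wpow]
lemma wpow_succ (u : List α) (r : ℕ) : wpow u (r+1) = u ++ wpow u r := by
  simp [wpow, List.replicate_succ]
lemma wpow_length (u : List α) (r : ℕ) : (wpow u r).length = r * u.length := by
  simp [wpow]
lemma wpow_succ' (u : List α) (r : ℕ) : wpow u (r+1) = wpow u r ++ u := by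
  induction r with
  | zero => simp [wpow]
  | succ r ih => rw [wpow_succ, ih, ← List.append_assoc, ← wpow_succ, ih]

lemma wpow_rotate_one (u : List α) (r : ℕ) : (wpow u r).rotate 1 = wpow (u.rotate 1) r := by
  cases u with
  | nil => simp [wpow]
  | cons a q =>
    have h : ∀ r, wpow (a :: q) r ++ [a] = a :: wpow (q ++ [a]) r := by
      intro r
      induction r with
      | zero => simp [wpow]
      | succ r ih => rw [wpow_succ, wpow_succ, List.append_assoc, ih]; simp
    cases r with
    | zero => simp [wpow]
    | succ r =>
      rw [wpow_succ]
      simp only [List.cons_append, List.rotate_cons_succ, List.rotate_zero]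
      rw [List.append_assoc, h, wpow_succ]; simp

lemma wpow_rotate (u : List α) (r i : ℕ) : (wpow u r).rotate i = wpow (u.rotate i) r := by
  induction i with
  | zero => simp
  | succ i ih => rw [← List.rotate_rotate, ih, wpow_rotate_one, List.rotate_rotate]

lemma take_wpow (u : List α) {r : ℕ} (hr : 0 < r) : (wpow u r).take u.length = u := by
  obtain ⟨r, rfl⟩ := Nat.exists_eq_succ_of_ne_zero hr.ne'
  rw [Nat.succ_eq_add_one, wpow_succ]; simp

lemma wpow_inj {u v : List α} {r : ℕ} (hr : 0 < r) (hl : u.length = v.length)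
    (h : wpow u r = wpow v r) : u = v := by
  rw [← take_wpow u hr, h, hl, take_wpow v hr]

lemma commute_eq_wpow (t : List α) (q : ℕ) : ∀ r : List α, r.length = q * t.length →
    r ++ t = t ++ r → r = wpow t q := by
  induction q with
  | zero => intro r hr _; simp at hr; simp [hr, wpow]
  | succ q ih =>
    intro r hr h
    have hle : t.length ≤ r.length := by rw [hr]; nlinarith
    have h1 : t <+: r := by
      have h2 : t <+: r ++ t := h ▸ List.prefix_append t r
      exact List.prefix_of_prefix_length_le h2 (List.prefix_append r t) hle
    obtain ⟨r', rfl⟩ := h1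
    rw [wpow_succ, ← ih r']
    · simp at hr; linarith
    · simpa using h

/-- rotation map -/
def rot (l : List α) : List α := l.rotate 1

lemma rot_iter (l : List α) (i : ℕ) : rot^[i] l = l.rotate i := by
  induction i with
  | zero => simp
  | succ i ih => rw [Function.iterate_succ_apply', ih, rot, List.rotate_rotate]

/-- minimal period -/
noncomputable def per (l : List α) : ℕ := Function.minimalPeriod rot l

lemma isPer_iff (l : List α) (i : ℕ) : Function.IsPeriodicPt rot i l ↔ l.rotate i = l := by
  rw [Function.IsPeriodicPt, Function.IsFixedPt, rot_iter]

lemma per_dvd_iff (l : List α) (i : ℕ) : per l ∣ i ↔ l.rotate i = l := by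
  rw [per, ← Function.isPeriodicPt_iff_minimalPeriod_dvd, isPer_iff]

lemma per_dvd_length (l : List α) : per l ∣ l.length := by
  rw [per_dvd_iff, List.rotate_length]

lemma rotate_per (l : List α) : l.rotate (per l) = l := (per_dvd_iff l _).1 dvd_rfl

lemma per_wpow (u : List α) {r : ℕ} (hr : 0 < r) : per (wpow u r) = per u := by
  rw [per, per, Function.minimalPeriod_eq_minimalPeriod_iff]
  intro i
  rw [isPer_iff, isPer_iff, wpow_rotate]
  exact ⟨fun h => wpow_inj hr (by simp) h, fun h => by rw [h]⟩

lemma per_rotate (u : List α) (i : ℕ) : per (u.rotate i) = per u := by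
  rw [per, per, Function.minimalPeriod_eq_minimalPeriod_iff]
  intro j
  rw [isPer_iff, isPer_iff, List.rotate_rotate, Nat.add_comm, ← List.rotate_rotate,
    List.rotate_eq_rotate]

/-- the primitive root of a word -/
noncomputable def root (l : List α) : List α := l.take (per l)

lemma per_pos {l : List α} (h : l ≠ []) : 0 < per l :=
  Nat.pos_of_dvd_of_pos (per_dvd_length l) (List.length_pos_iff.2 h)

lemma per_le {l : List α} (h : l ≠ []) : per l ≤ l.length :=
  Nat.le_of_dvd (List.length_pos_iff.2 h) (per_dvd_length l)

lemma root_length {l : List α} (h : l ≠ []) : (root l).length = per l := by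
  simp [root, per_le h]

lemma wpow_root {l : List α} (h : l ≠ []) : wpow (root l) (l.length / per l) = l := by
  obtain ⟨q, hq⟩ := per_dvd_length l
  have hp := per_pos h
  have hq0 : 0 < q := by
    rcases Nat.eq_zero_or_pos q with h0 | h0
    · subst h0; simp at hq; exact absurd hq h
    · exact h0
  obtain ⟨q, rfl⟩ := Nat.exists_eq_succ_of_ne_zero hq0.ne'
  have h1 : l.drop (per l) ++ root l = root l ++ l.drop (per l) := by
    rw [root, List.take_append_drop, ← List.rotate_eq_drop_append_take (per_le h), rotate_per]
  have h2 := commute_eq_wpow (root l) q (l.drop (per l))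
    (by rw [root_length h, List.length_drop]; conv_lhs => rw [hq]
        rw [Nat.succ_eq_add_one, Nat.mul_add, Nat.mul_comm]; simp) h1
  have h3 : l.length / per l = q + 1 := by
    rw [hq]; exact Nat.mul_div_cancel_left _ hp
  rw [h3, wpow_succ, ← h2, root, List.take_append_drop]

lemma primitive_iff (p : List α) : PrimitiveWord p ↔ p ≠ [] ∧ per p = p.length := by
  constructor
  · rintro ⟨h, h'⟩
    refine ⟨h, ?_⟩
    have h1 := h' (root p) (p.length / per p)
    have h2 : ¬ 2 ≤ p.length / per p := fun h3 => h1 h3 (wpow_root h).symm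
    obtain ⟨q, hq⟩ := per_dvd_length p
    rw [hq, Nat.mul_div_cancel_left _ (per_pos h)] at h2
    have : 0 < p.length := List.length_pos_iff.2 h
    have : q = 1 := by
      rcases Nat.eq_zero_or_pos q with h0 | h0
      · subst h0; omega
      · omega
    subst this; omega
  · rintro ⟨h, h'⟩
    refine ⟨h, fun u r hr hp => ?_⟩
    change p = wpow u r at hp
    have hu : u ≠ [] := by rintro rfl; apply h; simp [hp, wpow]
    have h1 := per_wpow u (r := r) (by omega)
    rw [← hp, h', hp, wpow_length] at h1
    have := per_le hu
    have : 0 < u.length := List.length_pos_iff.2 hu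
    nlinarith

lemma root_wpow {p : List α} (hp : PrimitiveWord p) {j : ℕ} (hj : 0 < j) :
    root (wpow p j) = p := by
  rw [root, per_wpow p hj, ((primitive_iff p).1 hp).2, take_wpow p hj]

lemma root_primitive {l : List α} (h : l ≠ []) : PrimitiveWord (root l) := by
  have h0 : root l ≠ [] := by
    rw [← List.length_pos_iff, root_length h]; exact per_pos h
  refine (primitive_iff _).2 ⟨h0, ?_⟩
  rw [root_length h]
  conv_rhs => rw [← wpow_root h]
  rw [per_wpow]
  exact Nat.div_pos (per_le h) (per_pos h)

lemma primitive_rotate {p : List α} (hp : PrimitiveWord p) (i : ℕ) :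
    PrimitiveWord (p.rotate i) := by
  rw [primitive_iff] at *
  simpa [per_rotate] using hp

/-- canonical representative of cyclic class -/
noncomputable def rep (w : List α) : List α :=
  (Quotient.mk (List.IsRotated.setoid α) w).out

lemma rep_isRotated (w : List α) : (rep w).IsRotated w :=
  Quotient.exact (Quotient.out_eq (Quotient.mk (List.IsRotated.setoid α) w))

lemma rep_eq_iff {w w' : List α} : rep w = rep w' ↔ w.IsRotated w' := by
  constructor
  · intro h; exact ((rep_isRotated w).symm.trans (h ▸ List.IsRotated.refl _)).trans (rep_isRotated w')
  · intro h
    have : Quotient.mk (List.IsRotated.setoid α) w = Quotient.mk (List.IsRotated.setoid α) w' :=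
      Quotient.sound h
    rw [rep, rep, this]

lemma rep_rep (w : List α) : rep (rep w) = rep w := rep_eq_iff.2 (rep_isRotated w)

lemma primitive_of_isRotated {p q : List α} (hp : PrimitiveWord p) (h : p.IsRotated q) :
    PrimitiveWord q := by
  obtain ⟨i, rfl⟩ := h; exact primitive_rotate hp i

variable [Fintype α]

/-- words of length `m` -/
noncomputable def wordsOf (α : Type*) [Fintype α] (m : ℕ) : Finset (List α) :=
  (List.finite_length_eq α m).toFinset

lemma mem_wordsOf {m : ℕ} {l : List α} : l ∈ wordsOf α m ↔ l.length = m := by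
  simp [wordsOf]

open Classical in
/-- representatives of primitive words of length at most n -/
noncomputable def primReps (α : Type*) [Fintype α] (n : ℕ) : Finset (List α) :=
  ((Finset.range (n+1)).biUnion (wordsOf α)).filter (fun w => PrimitiveWord w ∧ rep w = w)

lemma mem_primReps {n : ℕ} {w : List α} :
    w ∈ primReps α n ↔ w.length ≤ n ∧ PrimitiveWord w ∧ rep w = w := by
  simp [primReps, mem_wordsOf]

/-- the key counting lemma -/
lemma sum_words {R : Type*} [CommRing R] (τ : List α → R)
    (hτ : ∀ l i, τ (l.rotate i) = τ l) {n m : ℕ} (hm : 0 < m) (hmn : m ≤ n) :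
    ∑ l ∈ wordsOf α m, τ l =
      ∑ w ∈ primReps α n, if w.length ∣ m then (w.length : R) * τ (wpow w (m / w.length)) else 0 := by
  classical
  have hne : ∀ {l : List α}, l ∈ wordsOf α m → l ≠ [] := by
    intro l hl; rw [mem_wordsOf] at hl; rw [← List.length_pos_iff]; omega
  rw [← Finset.sum_fiberwise_of_maps_to (s := wordsOf α m) (t := primReps α n)
    (g := fun l => rep (root l))]
  · refine Finset.sum_congr rfl fun w hw => ?_
    rw [mem_primReps] at hw
    obtain ⟨hwn, hwp, hwr⟩ := hw
    obtain ⟨hw0, hwper⟩ := (primitive_iff w).1 hwp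
    have hwl : 0 < w.length := List.length_pos_iff.2 hw0
    have hkey : ∀ l ∈ wordsOf α m, rep (root l) = w → ∃ i < w.length,
        w.length ∣ m ∧ l = (wpow w (m / w.length)).rotate i := by
      intro l hl h
      have hl0 := hne hl
      have h1 : w.IsRotated (root l) := h ▸ rep_isRotated (root l)
      obtain ⟨i, hi⟩ := h1
      have hlen : w.length = per l := by rw [← root_length hl0, ← hi, List.length_rotate]
      have hlm := mem_wordsOf.1 hl
      refine ⟨i % w.length, Nat.mod_lt _ hwl, ?_, ?_⟩
      · rw [hlen, ← hlm]; exact per_dvd_length l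
      · rw [wpow_rotate, List.rotate_mod, hi, hlen, ← hlm, wpow_root hl0]
    split_ifs with hd
    · have hj : 0 < m / w.length := Nat.div_pos (Nat.le_of_dvd hm hd) hwl
      have himg : (wordsOf α m).filter (fun l => rep (root l) = w) =
          (Finset.range w.length).image (fun i => (wpow w (m / w.length)).rotate i) := by
        ext l
        simp only [Finset.mem_filter, Finset.mem_image, Finset.mem_range]
        constructor
        · rintro ⟨h1, h2⟩
          obtain ⟨i, hi, _, h⟩ := hkey l h1 h2
          exact ⟨i, hi, h.symm⟩
        · rintro ⟨i, hi, rfl⟩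
          refine ⟨?_, ?_⟩
          · rw [mem_wordsOf, List.length_rotate, wpow_length, Nat.div_mul_cancel hd]
          · rw [wpow_rotate, root_wpow (primitive_rotate hwp i) hj]
            conv_rhs => rw [← hwr]
            exact rep_eq_iff.2 (List.IsRotated.forall w i)
      rw [himg, Finset.sum_image]
      · simp [hτ]
      · intro i hi j hj' hij
        simp only [Finset.coe_range, Set.mem_Iio] at hi hj'
        have hpp : per (wpow w (m / w.length)) = w.length := by rw [per_wpow w hj, hwper]
        dsimp only at hij
        rw [← rot_iter, ← rot_iter] at hij
        exact Function.iterate_injOn_Iio_minimalPeriod (f := rot) (x := wpow w (m / w.length))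
          (by rw [Set.mem_Iio]; change i < per _; omega)
          (by rw [Set.mem_Iio]; change j < per _; omega) hij
    · rw [Finset.sum_eq_zero]
      intro l hl
      rw [Finset.mem_filter] at hl
      obtain ⟨i, _, h, _⟩ := hkey l hl.1 hl.2
      exact absurd h hd
  · intro l hl
    have hl0 := hne hl
    rw [mem_primReps]
    refine ⟨?_, primitive_of_isRotated (root_primitive hl0) (rep_isRotated _).symm, rep_rep _⟩
    rw [(rep_isRotated (root l)).perm.length_eq, root_length hl0]
    have := per_le hl0
    rw [mem_wordsOf] at hl; omega

lemma sum_pow_words [DecidableEq α] {R : Type*} [Ring R] (Z : α → R) (m : ℕ) :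
    (∑ a, Z a) ^ m = ∑ l ∈ wordsOf α m, (l.map Z).prod := by
  induction m with
  | zero =>
    have : wordsOf α 0 = {[]} := by ext l; simp [mem_wordsOf]
    simp [this]
  | succ m ih =>
    have : wordsOf α (m+1) = (Finset.univ ×ˢ wordsOf α m).image (fun p : α × List α => p.1 :: p.2) := by
      ext l
      cases l with
      | nil => simp [mem_wordsOf]
      | cons a l => simp [mem_wordsOf]
    rw [pow_succ', ih, this, Finset.sum_image, Finset.sum_product, Finset.sum_mul_sum]
    · simp
    · rintro ⟨a, l⟩ _ ⟨b, l'⟩ _ h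
      simpa using h

end Words
section Polys
open Polynomial

lemma jacobi_det {R : Type*} [CommRing R] {n : ℕ} (M : Matrix (Fin n) (Fin n) R[X]) :
    derivative M.det = (M.adjugate * M.map derivative).trace := by
  have h1 : (M.adjugate * M.map derivative).trace
      = ∑ i, (M.updateCol i (fun j => derivative (M j i))).det := by
    rw [Matrix.trace]
    refine Finset.sum_congr rfl fun i _ => ?_
    rw [← Matrix.cramer_apply, Matrix.cramer_eq_adjugate_mulVec]
    rfl
  rw [h1]
  simp_rw [Matrix.det_apply]
  rw [Finset.sum_comm, derivative_sum]
  refine Finset.sum_congr rfl fun σ _ => ?_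
  rw [← Finset.smul_sum]
  have h2 : ∀ (u : ℤˣ) (p : R[X]), derivative (u • p) = u • derivative p := by
    intro u p
    rcases Int.units_eq_one_or u with rfl | rfl <;> simp
  rw [h2, derivative_prod_finset]
  congr 1
  refine Finset.sum_congr rfl fun i _ => ?_
  rw [← Finset.mul_prod_erase Finset.univ _ (Finset.mem_univ i), mul_comm]
  congr 1
  · simp
  · refine Finset.prod_congr rfl fun j hj => ?_
    rw [Matrix.updateCol_ne (Finset.ne_of_mem_erase hj)]

/-- logarithmic derivative relation modulo `X^N`. -/
def LD {R : Type*} [CommRing R] (N : ℕ) (f h : R[X]) : Prop :=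
  X ^ N ∣ X * derivative f - f * h

variable {R : Type*} [CommRing R]

lemma LD_one (N : ℕ) : LD N (1 : R[X]) 0 := by simp [LD]

lemma LD_mul {N : ℕ} {f g a b : R[X]} (hf : LD N f a) (hg : LD N g b) :
    LD N (f * g) (a + b) := by
  have := dvd_add (hf.mul_left g) (hg.mul_left f)
  unfold LD
  convert this using 1
  rw [derivative_mul]; ring

lemma LD_prod {ι : Type*} {N : ℕ} (s : Finset ι) (f h : ι → R[X])
    (H : ∀ i ∈ s, LD N (f i) (h i)) : LD N (∏ i ∈ s, f i) (∑ i ∈ s, h i) := by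
  classical
  induction s using Finset.induction_on with
  | empty => simpa using LD_one N
  | insert a s ha ih =>
    rw [Finset.prod_insert ha, Finset.sum_insert ha]
    exact LD_mul (H a (by simp)) (ih fun i hi => H i (by simp [hi]))

lemma LD_expand {N : ℕ} {f h : R[X]} (hf : LD N f h) {l : ℕ} (hl : 0 < l) :
    LD N (expand R l f) ((l : R[X]) * expand R l h) := by
  obtain ⟨q, hq⟩ := hf
  have h1 := congrArg (expand R l) hq
  simp only [map_sub, map_mul, map_pow, expand_X] at h1
  unfold LD
  have h2 : X * derivative (expand R l f) - expand R l f * ((l : R[X]) * expand R l h)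
      = (l : R[X]) * ((X ^ l) ^ N * expand R l q) := by
    rw [← h1, derivative_expand]
    have : (X : R[X]) ^ l = X * X ^ (l - 1) := by
      rw [← pow_succ', Nat.sub_add_cancel hl]
    rw [this]; ring
  rw [h2, ← pow_mul]
  refine Dvd.dvd.mul_left (Dvd.dvd.mul_right (pow_dvd_pow _ ?_) _) _
  nlinarith

lemma LD_congr {N : ℕ} {f h h' : R[X]} (hf : LD N f h) (hh : X ^ N ∣ h - h') : LD N f h' := by
  have := dvd_add hf (hh.mul_left f)
  unfold LD
  convert this using 1
  ring

lemma LD_unique [IsDomain R] [CharZero R] {N : ℕ} {f g h : R[X]} (hf : LD N f h) (hg : LD N g h)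
    (h0 : f.coeff 0 = g.coeff 0) (hh : h.coeff 0 = 0) : ∀ m < N, f.coeff m = g.coeff m := by
  have hd : LD N (f - g) h := by
    have := dvd_sub hf hg
    unfold LD
    convert this using 1
    rw [derivative_sub]; ring
  have key : ∀ m < N, (f - g).coeff m = 0 := by
    intro m
    induction m using Nat.strong_induction_on with
    | _ m ih =>
      intro hm
      rcases m with _ | m
      · simp [h0]
      · have h1 := (X_pow_dvd_iff.1 hd) (m+1) hm
        rw [coeff_sub, coeff_X_mul, coeff_derivative, coeff_mul, Finset.sum_eq_zero, sub_zero] at h1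
        · rcases mul_eq_zero.1 h1 with h2 | h2
          · exact h2
          · exact absurd h2 (by exact_mod_cast Nat.succ_ne_zero m)
        · rintro ⟨a, b⟩ hab
          rw [Finset.HasAntidiagonal.mem_antidiagonal] at hab
          dsimp only at hab ⊢
          rcases Nat.eq_zero_or_pos b with hb | hb
          · subst hb; rw [hh, mul_zero]
          · rw [ih a (by omega) (by omega), zero_mul]
  intro m hm
  have := key m hm
  rwa [coeff_sub, sub_eq_zero] at this

open Matrix in
lemma LD_charpolyRev {n : ℕ} (Y : Matrix (Fin n) (Fin n) R) (N : ℕ) :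
    LD N Y.charpolyRev (-∑ m ∈ Finset.range N, C ((Y ^ (m+1)).trace) * X ^ (m+1)) := by
  set M : Matrix (Fin n) (Fin n) R[X] := 1 - (X : R[X]) • Y.map C with hM
  set T : Matrix (Fin n) (Fin n) R[X] := (X : R[X]) • Y.map C with hT
  have hF : Y.charpolyRev = M.det := rfl
  have hder : (X : R[X]) • M.map derivative = - T := by
    refine Matrix.ext fun i j => ?_
    by_cases hij : i = j <;> simp [hM, hT, hij]
  have h1 : X * derivative M.det = - (M.adjugate * T).trace := by
    rw [jacobi_det, ← smul_eq_mul, ← Matrix.trace_smul, ← Matrix.mul_smul, hder, Matrix.mul_neg,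
      Matrix.trace_neg]
  have hgeom : (∑ m ∈ Finset.range N, T ^ m) * M = 1 - T ^ N := by
    have := geom_sum_mul_neg T N
    exact this
  have hgeom' : M * (∑ m ∈ Finset.range N, T ^ m) = 1 - T ^ N := mul_neg_geom_sum T N
  have h2 : M.adjugate - M.adjugate * T ^ N = M.det • (∑ m ∈ Finset.range N, T ^ m) := by
    have : M.adjugate * (M * (∑ m ∈ Finset.range N, T ^ m)) = M.adjugate * (1 - T ^ N) := by
      rw [hgeom']
    rw [← Matrix.mul_assoc, Matrix.adjugate_mul, Matrix.smul_mul, Matrix.one_mul, Matrix.mul_sub,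
      Matrix.mul_one] at this
    exact this.symm
  have hTp : ∀ m, T ^ m = (X ^ m : R[X]) • (Y ^ m).map C := by
    intro m
    rw [hT, _root_.smul_pow]
    congr 1
    exact (map_pow (RingHom.mapMatrix (C : R →+* R[X])) Y m).symm
  have htr : ∀ m, (T ^ m).trace = C ((Y ^ m).trace) * X ^ m := by
    intro m
    rw [hTp, Matrix.trace_smul, smul_eq_mul, mul_comm]
    congr 1
    simp [Matrix.trace]
  have h3 : (M.adjugate * T).trace = M.det * (∑ m ∈ Finset.range N, C ((Y ^ (m+1)).trace) * X ^ (m+1))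
      + X ^ N * (M.adjugate * (Y ^ N).map C * T).trace := by
    have : M.adjugate = M.det • (∑ m ∈ Finset.range N, T ^ m) + M.adjugate * T ^ N := by
      rw [← h2]; abel
    conv_lhs => rw [this]
    rw [Matrix.add_mul, Matrix.trace_add, Matrix.smul_mul, Matrix.trace_smul, Finset.sum_mul,
      Matrix.trace_sum]
    simp_rw [← pow_succ, htr]
    have e : M.adjugate * T ^ N * T = (X ^ N : R[X]) • (M.adjugate * (Y ^ N).map C * T) := by
      rw [hTp, Matrix.mul_smul M.adjugate, Matrix.smul_mul]
    rw [e, Matrix.trace_smul, smul_eq_mul, smul_eq_mul]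
  unfold LD
  rw [hF, h1, h3]
  refine ⟨-(M.adjugate * (Y ^ N).map C * T).trace, ?_⟩
  ring

lemma charpolyRev_smul {n : ℕ} (c : R) (Y : Matrix (Fin n) (Fin n) R) (i : ℕ) :
    (c • Y).charpolyRev.coeff i = Y.charpolyRev.coeff i * c ^ i := by
  rw [← comp_C_mul_X_coeff]
  congr 1
  rw [Matrix.charpolyRev, Matrix.charpolyRev]
  change _ = compRingHom (C c * X) _
  rw [RingHom.map_det]
  congr 1
  refine Matrix.ext fun a b => ?_
  by_cases hab : a = b <;> simp [hab] <;> ring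

lemma charpolyRev_map {S : Type*} [CommRing S] {n : ℕ} (φ : R →+* S)
    (Y : Matrix (Fin n) (Fin n) R) (i : ℕ) :
    (Y.map φ).charpolyRev.coeff i = φ (Y.charpolyRev.coeff i) := by
  rw [← coeff_map]
  congr 1
  rw [Matrix.charpolyRev, Matrix.charpolyRev]
  change _ = mapRingHom φ _
  rw [RingHom.map_det]
  congr 1
  refine Matrix.ext fun a b => ?_
  by_cases hab : a = b <;> simp [hab]

lemma charpolyRev_coeff [Nontrivial R] {n : ℕ} (Y : Matrix (Fin n) (Fin n) R) {i : ℕ} (hi : i ≤ n) :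
    Y.charpolyRev.coeff i = Y.charpoly.coeff (n - i) := by
  rw [← Matrix.reverse_charpoly, coeff_reverse, Matrix.charpoly_natDegree_eq_dim, Fintype.card_fin,
    revAt_le hi]

lemma charpolyRev_natDegree [Nontrivial R] {n : ℕ} (Y : Matrix (Fin n) (Fin n) R) :
    Y.charpolyRev.natDegree < n + 1 := by
  rw [← Matrix.reverse_charpoly, Nat.lt_succ_iff]
  refine (reverse_natDegree_le _).trans ?_
  rw [Matrix.charpoly_natDegree_eq_dim, Fintype.card_fin]

lemma charpolyRev_coeff_zero {n : ℕ} (Y : Matrix (Fin n) (Fin n) R) :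
    Y.charpolyRev.coeff 0 = 1 := by
  rw [coeff_zero_eq_eval_zero, Matrix.eval_charpolyRev]

/-- factorisation of `det(1 - t Y)` modulo `t^{n+1}`. -/
lemma factorisation [IsDomain R] [CharZero R] {n s : ℕ} (Z : Fin s → Matrix (Fin n) (Fin n) R) :
    ∀ m < n + 1, (∑ r, Z r).charpolyRev.coeff m =
      (∏ w ∈ primReps (Fin s) n, expand R w.length ((w.map Z).prod).charpolyRev).coeff m := by
  have hpos : ∀ w ∈ primReps (Fin s) n, 0 < w.length := by
    intro w hw
    exact List.length_pos_iff.2 (mem_primReps.1 hw).2.1.1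
  have hG := LD_prod (N := n+1) (primReps (Fin s) n)
    (fun w => expand R w.length ((w.map Z).prod).charpolyRev) _
    (fun w hw => LD_expand (LD_charpolyRev ((w.map Z).prod) (n+1)) (hpos w hw))
  have hF := LD_charpolyRev (∑ r, Z r) (n+1)
  refine LD_unique hF (LD_congr hG ?_) ?_ ?_
  · rw [X_pow_dvd_iff]
    intro m hm
    rw [coeff_sub, sub_eq_zero]
    have hR : ∀ (Y : Matrix (Fin n) (Fin n) R) (m : ℕ), m < n + 1 →
        (-∑ m ∈ Finset.range (n+1), C ((Y ^ (m+1)).trace) * X ^ (m+1)).coeff m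
          = if m = 0 then 0 else - (Y ^ m).trace := by
      intro Y m hm
      rw [coeff_neg, finsetSum_coeff]
      simp_rw [coeff_C_mul_X_pow]
      rcases m with _ | m
      · simp
      · simp only [Nat.add_right_cancel_iff, Nat.succ_ne_zero, if_false]
        rw [Finset.sum_ite_eq]
        simp [show m < n + 1 by omega]
    rw [hR _ _ hm, finsetSum_coeff]
    have hL : ∀ w ∈ primReps (Fin s) n, ((w.length : R[X]) * expand R w.length
        (-∑ m ∈ Finset.range (n+1), C ((((w.map Z).prod) ^ (m+1)).trace) * X ^ (m+1))).coeff m =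
        if w.length ∣ m then (w.length : R) *
          (if m = 0 then 0 else - (((w.map Z).prod) ^ (m / w.length)).trace) else 0 := by
      intro w hw
      rw [← C_eq_natCast, coeff_C_mul, coeff_expand (hpos w hw)]
      split_ifs with h1 h2
      · subst h2; rw [Nat.zero_div, hR _ _ (by omega)]; simp
      · have h3 := Nat.div_le_self m w.length
        have h4 := Nat.div_pos (Nat.le_of_dvd (Nat.pos_of_ne_zero h2) h1) (hpos w hw)
        rw [hR _ _ (by omega), if_neg (by omega)]
      · simp
    rw [Finset.sum_congr rfl hL]
    split_ifs with h0
    · simp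
    · rw [sum_pow_words, Matrix.trace_sum]
      have := sum_words (fun l : List (Fin s) => ((l.map Z).prod).trace) ?_ (Nat.pos_of_ne_zero h0)
        (Nat.lt_succ_iff.1 hm)
      · rw [this, ← Finset.sum_neg_distrib]
        refine Finset.sum_congr rfl fun w hw => ?_
        split_ifs
        · rw [wpow, List.map_flatten, List.prod_flatten, List.map_replicate, List.map_replicate,
            List.prod_replicate]
          ring
        · simp
      · intro l i
        rw [List.rotate_eq_drop_append_take_mod, List.map_append, List.prod_append,
          Matrix.trace_mul_comm, ← List.prod_append, ← List.map_append, List.take_append_drop]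
  · rw [charpolyRev_coeff_zero, coeff_zero_prod, Finset.prod_eq_one]
    intro w hw
    rw [coeff_expand (hpos w hw)]
    simp [charpolyRev_coeff_zero]
  · simp [coeff_neg, finsetSum_coeff]

end Polys
section Final

/-- multidegree of a word -/
noncomputable def wdeg {s : ℕ} (w : List (Fin s)) : Fin s →₀ ℕ :=
  Finsupp.equivFunOnFinite.symm (fun j => w.count j)

lemma wdeg_cons {s : ℕ} (a : Fin s) (w : List (Fin s)) :
    wdeg (a :: w) = Finsupp.single a 1 + wdeg w := by
  ext j
  simp [wdeg, List.count_cons, Finsupp.single_apply, add_comm]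

lemma wdeg_apply {s : ℕ} (w : List (Fin s)) (j : Fin s) : wdeg w j = w.count j := rfl

lemma sum_count_word {s : ℕ} (w : List (Fin s)) : ∑ j, w.count j = w.length := by
  have := Multiset.sum_count_eq_card (s := Finset.univ) (m := (w : Multiset (Fin s))) (by simp)
  simpa using this

lemma word_prod {B : Type*} [CommRing B] {n s : ℕ} (X : Fin s → Matrix (Fin n) (Fin n) B)
    (w : List (Fin s)) :
    (w.map (fun r => (MvPolynomial.X r : MvPolynomial (Fin s) B) • (X r).map (MvPolynomial.C : B →+* MvPolynomial (Fin s) B))).prod =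
      MvPolynomial.monomial (wdeg w) (1 : B) • ((w.map X).prod).map (MvPolynomial.C : B →+* MvPolynomial (Fin s) B) := by
  induction w with
  | nil =>
    have : wdeg ([] : List (Fin s)) = 0 := by ext j; simp [wdeg]
    simp [this]
    exact (map_one (RingHom.mapMatrix (m := Fin n) (MvPolynomial.C : B →+* MvPolynomial (Fin s) B))).symm
  | cons a w ih =>
    rw [List.map_cons, List.prod_cons, ih, wdeg_cons, List.map_cons, List.prod_cons,
      Matrix.map_mul, Matrix.smul_mul, Matrix.mul_smul, smul_smul]
    congr 1
    rw [MvPolynomial.X, MvPolynomial.monomial_mul, one_mul]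

lemma prod_monomials {B ι σ : Type*} [CommRing B] (t : Finset ι) (a : ι → ℕ) (b : ι → σ →₀ ℕ)
    (c : ι → B) :
    ∏ i ∈ t, Polynomial.monomial (a i) (MvPolynomial.monomial (b i) (c i)) =
      Polynomial.monomial (∑ i ∈ t, a i) (MvPolynomial.monomial (∑ i ∈ t, b i) (∏ i ∈ t, c i)) := by
  classical
  induction t using Finset.induction_on with
  | empty => simp
  | insert i t hi ih =>
    rw [Finset.prod_insert hi, Finset.sum_insert hi, Finset.sum_insert hi, Finset.prod_insert hi, ih,
      Polynomial.monomial_mul_monomial, MvPolynomial.monomial_mul]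

open Classical in
lemma detLin_expand {B : Type*} [CommRing B] [IsDomain B] [CharZero B] {n s : ℕ} (k : Fin s → ℕ)
    (hsum : ∑ j, k j = n) (X : Fin s → Matrix (Fin n) (Fin n) B) :
    (-1) ^ n * detLin k X = ∑ g ∈ (Fintype.piFinset
        (fun _ : {w // w ∈ primReps (Fin s) n} => Finset.range (n+1))).filter
          (fun g => ∀ j, ∑ w, g w * w.1.count j = k j),
      ∏ w : {w // w ∈ primReps (Fin s) n}, ((w.1.map X).prod).charpolyRev.coeff (g w) := by
  set Z : Fin s → Matrix (Fin n) (Fin n) (MvPolynomial (Fin s) B) :=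
    fun r => (MvPolynomial.X r : MvPolynomial (Fin s) B) • (X r).map MvPolynomial.C with hZ
  have hY : (Matrix.of fun i j =>
      ∑ r, (MvPolynomial.X r : MvPolynomial (Fin s) B) * MvPolynomial.C (X r i j)) = ∑ r, Z r := by
    ext1 i j
    simp [hZ, Matrix.sum_apply]
  have h1 : (-1) ^ n * detLin k X =
      MvPolynomial.coeff (Finsupp.equivFunOnFinite.symm k) ((∑ r, Z r).charpolyRev.coeff n) := by
    rw [detLin, hY, charpolyRev_coeff _ le_rfl, Nat.sub_self, Matrix.det_eq_sign_charpoly_coeff,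
      Fintype.card_fin]
    have : ((-1 : MvPolynomial (Fin s) B)) ^ n = MvPolynomial.C ((-1) ^ n) := by simp
    rw [this, MvPolynomial.coeff_C_mul, ← mul_assoc, ← mul_pow]
    simp
  rw [h1, factorisation Z n (Nat.lt_succ_self n)]
  have h2 : ∀ w : List (Fin s), Polynomial.expand (MvPolynomial (Fin s) B) w.length
      ((w.map Z).prod).charpolyRev = ∑ i ∈ Finset.range (n+1),
        Polynomial.monomial (i * w.length) (MvPolynomial.monomial (i • wdeg w)
          (((w.map X).prod).charpolyRev.coeff i)) := by
    intro w
    conv_lhs => rw [Polynomial.as_sum_range' _ (n+1) (charpolyRev_natDegree ((w.map Z).prod))]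
    rw [map_sum]
    refine Finset.sum_congr rfl fun i _ => ?_
    rw [Polynomial.expand_monomial, word_prod, charpolyRev_smul, charpolyRev_map,
      MvPolynomial.monomial_pow, MvPolynomial.C_mul_monomial]
    simp
  rw [Finset.prod_congr rfl fun w _ => h2 w]
  rw [← Finset.prod_coe_sort, Finset.prod_univ_sum, Polynomial.finsetSum_coeff,
    MvPolynomial.coeff_sum, Finset.sum_filter]
  refine Finset.sum_congr rfl fun g _ => ?_
  rw [prod_monomials, Polynomial.coeff_monomial]
  have h3 : (∑ w : {w // w ∈ primReps (Fin s) n}, g w • wdeg w.1) = Finsupp.equivFunOnFinite.symm k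
      ↔ ∀ j, ∑ w, g w * w.1.count j = k j := by
    rw [Finsupp.ext_iff]
    refine forall_congr' fun j => ?_
    rw [Finsupp.finsetSum_apply]
    simp [wdeg_apply]
  by_cases h4 : ∀ j, ∑ w, g w * w.1.count j = k j
  · have h5 : ∑ w : {w // w ∈ primReps (Fin s) n}, g w * w.1.length = n := by
      refine Eq.trans ?_ hsum
      rw [← Finset.sum_congr rfl fun j _ => h4 j, Finset.sum_comm]
      refine Finset.sum_congr rfl fun w _ => ?_
      rw [← Finset.mul_sum, sum_count_word]
    rw [if_pos h4, if_pos h5, MvPolynomial.coeff_monomial, if_pos (h3.2 h4)]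
  · rw [if_neg h4]
    split_ifs
    · rw [MvPolynomial.coeff_monomial, if_neg (mt h3.1 h4)]
    · simp

lemma charpolyRev_isRotated {B : Type*} [CommRing B] [Nontrivial B] {n s : ℕ}
    (X : Fin s → Matrix (Fin n) (Fin n) B) {w w' : List (Fin s)} (h : w.IsRotated w') :
    ((w.map X).prod).charpolyRev = ((w'.map X).prod).charpolyRev := by
  obtain ⟨i, rfl⟩ := h
  rw [← Matrix.reverse_charpoly, ← Matrix.reverse_charpoly]
  rw [List.rotate_eq_drop_append_take_mod, List.map_append, List.prod_append,
    Matrix.charpoly_mul_comm, ← List.prod_append, ← List.map_append, List.take_append_drop]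

lemma sum_map_primReps {s n : ℕ} (N : Multiset (List (Fin s)))
    (hN : ∀ w ∈ N, w ∈ primReps (Fin s) n) (f : List (Fin s) → ℕ) :
    (N.map f).sum = ∑ w : {w // w ∈ primReps (Fin s) n}, N.count w.1 * f w.1 := by
  rw [Finset.sum_coe_sort (primReps (Fin s) n) (fun w => N.count w * f w),
    Finset.sum_multiset_map_count]
  refine Finset.sum_subset (fun w hw => hN w (Multiset.mem_toFinset.1 hw)) fun w _ hw => ?_
  rw [Multiset.mem_toFinset] at hw
  simp [hw]

lemma index_length {s n : ℕ} {k : Fin s → ℕ} (hsum : ∑ j, k j = n) {M : Multiset (List (Fin s))}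
    (hM : AmitsurIndex k M) : (M.map List.length).sum = n := by
  rw [← hsum, ← Finset.sum_congr rfl fun j _ => hM.2.2 j]
  simp_rw [← sum_count_word]
  exact Multiset.sum_map_sum

lemma index_card {s n : ℕ} {k : Fin s → ℕ} (hsum : ∑ j, k j = n) {M : Multiset (List (Fin s))}
    (hM : AmitsurIndex k M) : M.card ≤ n := by
  rw [← index_length hsum hM]
  have := Multiset.card_nsmul_le_sum (s := M.map List.length) (a := 1) (by
    intro x hx
    obtain ⟨w, hw, rfl⟩ := Multiset.mem_map.1 hx
    exact List.length_pos_iff.2 (hM.1 w hw).1)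
  simpa using this

lemma index_map_rep {s n : ℕ} {k : Fin s → ℕ} (hsum : ∑ j, k j = n) {M : Multiset (List (Fin s))}
    (hM : AmitsurIndex k M) : ∀ w ∈ M.map rep, w ∈ primReps (Fin s) n := by
  intro w hw
  obtain ⟨v, hv, rfl⟩ := Multiset.mem_map.1 hw
  rw [mem_primReps]
  refine ⟨?_, primitive_of_isRotated (hM.1 v hv) (rep_isRotated v).symm, rep_rep v⟩
  rw [(rep_isRotated v).perm.length_eq, ← index_length hsum hM]
  exact Multiset.le_sum_of_mem (Multiset.mem_map_of_mem _ hv)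

lemma rel_iff_map_rep {α : Type*} (M M' : Multiset (List α)) :
    Multiset.Rel (fun w w' => w.IsRotated w') M M' ↔ M.map rep = M'.map rep := by
  rw [← Multiset.rel_eq, Multiset.rel_map]
  simp_rw [rep_eq_iff]

lemma generic_case {B : Type*} [CommRing B] [IsDomain B] [CharZero B]
    (n s : ℕ) (k : Fin s → ℕ) (hsum : ∑ j, k j = n)
    (X : Fin s → Matrix (Fin n) (Fin n) B)
    (S : Finset (Multiset (List (Fin s))))
    (hS₁ : ∀ M ∈ S, AmitsurIndex k M)
    (hS₂ : ∀ M, AmitsurIndex k M →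
      ∃! M', M' ∈ S ∧ Multiset.Rel (fun w w' => w.IsRotated w') M M') :
    detLin k X = ∑ M ∈ S, (-1 : B) ^ (n + Multiset.card M) *
      ∏ w ∈ M.toFinset, sigmaCoeff n ((w.map X).prod) (M.count w) := by
  classical
  have hmain : ∑ M ∈ S, (-1 : B) ^ (Multiset.card M) *
      ∏ w ∈ M.toFinset, sigmaCoeff n ((w.map X).prod) (M.count w) = (-1) ^ n * detLin k X := by
    rw [detLin_expand k hsum X]
    refine Finset.sum_bij (fun M _ => fun w => (M.map rep).count w.1) ?_ ?_ ?_ ?_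
    · intro M hM
      have hI := hS₁ M hM
      simp only [Finset.mem_filter, Fintype.mem_piFinset, Finset.mem_range, Nat.lt_succ_iff]
      refine ⟨fun w => ?_, fun j => ?_⟩
      · refine (Multiset.count_le_card _ _).trans ?_
        rw [Multiset.card_map]; exact index_card hsum hI
      · rw [← sum_map_primReps (M.map rep) (index_map_rep hsum hI) (fun w => w.count j),
          Multiset.map_map, ← hI.2.2 j]
        congr 1
        refine Multiset.map_congr rfl fun w _ => ?_
        exact (rep_isRotated w).perm.count_eq j
    · intro M hM M' hM' h
      have hI := hS₁ M hM
      have hI' := hS₁ M' hM'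
      have heq : M.map rep = M'.map rep := by
        ext w
        by_cases hw : w ∈ primReps (Fin s) n
        · exact congrFun h ⟨w, hw⟩
        · rw [Multiset.count_eq_zero_of_notMem fun h1 => hw (index_map_rep hsum hI w h1),
            Multiset.count_eq_zero_of_notMem fun h1 => hw (index_map_rep hsum hI' w h1)]
      exact (hS₂ M hI).unique ⟨hM, (rel_iff_map_rep _ _).2 rfl⟩ ⟨hM', (rel_iff_map_rep _ _).2 heq⟩
    · intro g hg
      simp only [Finset.mem_filter, Fintype.mem_piFinset] at hg
      set N : Multiset (List (Fin s)) :=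
        ∑ w : {w // w ∈ primReps (Fin s) n}, Multiset.replicate (g w) w.1 with hN
      have hcount : ∀ w : {w // w ∈ primReps (Fin s) n}, N.count w.1 = g w := by
        intro w
        rw [hN, Multiset.count_sum', Finset.sum_eq_single w]
        · simp
        · intro b _ hb
          rw [Multiset.count_replicate, if_neg fun h => hb (Subtype.ext h)]
        · simp
      have hmem : ∀ w ∈ N, w ∈ primReps (Fin s) n := by
        intro w hw
        rw [hN, Multiset.mem_sum] at hw
        obtain ⟨v, _, hv⟩ := hw
        rw [Multiset.eq_of_mem_replicate hv]; exact v.2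
      have hI : AmitsurIndex k N := by
        refine ⟨fun w hw => (mem_primReps.1 (hmem w hw)).2.1, fun w hw w' hw' h => ?_, fun j => ?_⟩
        · rw [← (mem_primReps.1 (hmem w hw)).2.2, ← (mem_primReps.1 (hmem w' hw')).2.2]
          exact rep_eq_iff.2 h
        · rw [sum_map_primReps N hmem (fun w => w.count j), ← hg.2 j]
          exact Finset.sum_congr rfl fun w _ => by rw [hcount]
      obtain ⟨M, ⟨hM, hrel⟩, _⟩ := hS₂ N hI
      refine ⟨M, hM, ?_⟩
      funext w
      have hNr : N.map rep = N := by
        conv_rhs => rw [← Multiset.map_id N]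
        exact Multiset.map_congr rfl fun w hw => (mem_primReps.1 (hmem w hw)).2.2
      rw [← (rel_iff_map_rep _ _).1 hrel, hNr, hcount]
    · intro M hM
      have hI := hS₁ M hM
      have hinj : Set.InjOn rep {x | x ∈ M} := fun w hw w' hw' h =>
        hI.2.1 w hw w' hw' (rep_eq_iff.1 h)
      rw [Finset.prod_coe_sort (primReps (Fin s) n)
        (fun w => ((w.map X).prod).charpolyRev.coeff ((M.map rep).count w))]
      rw [← Finset.prod_subset (s₁ := (M.map rep).toFinset)
        (fun w hw => index_map_rep hsum hI w (Multiset.mem_toFinset.1 hw))]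
      · rw [Multiset.toFinset_map, Finset.prod_image, ← Multiset.toFinset_sum_count_eq M,
          ← Finset.prod_pow_eq_pow_sum, ← Finset.prod_mul_distrib]
        · refine Finset.prod_congr rfl fun w hw => ?_
          rw [Multiset.mem_toFinset] at hw
          rw [Multiset.count_map_eq_count rep M hinj w hw, charpolyRev_isRotated X (rep_isRotated w),
            charpolyRev_coeff _ ((Multiset.count_le_card _ _).trans (index_card hsum hI)), sigmaCoeff,
            ← mul_assoc, ← mul_pow]
          simp
        · intro w hw w' hw' h
          exact hinj (by simpa using hw) (by simpa using hw') h
      · intro w _ hw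
        rw [Multiset.mem_toFinset] at hw
        rw [Multiset.count_eq_zero_of_notMem hw, charpolyRev_coeff_zero]
  have h2 : ((-1 : B) ^ n * (-1) ^ n) = 1 := by rw [← mul_pow]; simp
  calc detLin k X = (-1 : B) ^ n * ((-1) ^ n * detLin k X) := by rw [← mul_assoc, h2, one_mul]
    _ = _ := by
      rw [← hmain, Finset.mul_sum]
      refine Finset.sum_congr rfl fun M _ => ?_
      rw [pow_add, mul_assoc]

lemma sigmaCoeff_map {A B : Type*} [CommRing A] [CommRing B] (φ : B →+* A) (n : ℕ)
    (M : Matrix (Fin n) (Fin n) B) (i : ℕ) :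
    sigmaCoeff n (M.map φ) i = φ (sigmaCoeff n M i) := by
  rw [sigmaCoeff, sigmaCoeff, Matrix.charpoly_map, Polynomial.coeff_map]
  simp

lemma detLin_map {A B : Type*} [CommRing A] [CommRing B] (φ : B →+* A) {n s : ℕ} (k : Fin s → ℕ)
    (X : Fin s → Matrix (Fin n) (Fin n) B) :
    detLin k (fun r => (X r).map φ) = φ (detLin k X) := by
  rw [detLin, detLin, ← MvPolynomial.coeff_map, RingHom.map_det]
  congr 2
  ext1 i j
  simp

lemma words_map {A B : Type*} [CommRing A] [CommRing B] (φ : B →+* A) {n s : ℕ}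
    (X : Fin s → Matrix (Fin n) (Fin n) B) (w : List (Fin s)) :
    (w.map (fun r => (X r).map φ)).prod = ((w.map X).prod).map φ := by
  have := map_list_prod (RingHom.mapMatrix (m := Fin n) φ) (w.map X)
  rw [List.map_map] at this
  exact this.symm

end Final

theorem stmt6 (K : Type*) [Field K] [Infinite K] (A : Type*) [CommRing A] [Algebra K A]
    (n s : ℕ) (hn : 0 < n) (k : Fin s → ℕ) (hk : ∀ j, 0 < k j) (hsum : ∑ j, k j = n)
    (X : Fin s → Matrix (Fin n) (Fin n) A)
    -- `S` is a set of representatives of the equivalence classes (up to cyclic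
    -- permutation of each word) of multisets satisfying the index conditions
    (S : Finset (Multiset (List (Fin s))))
    (hS₁ : ∀ M ∈ S, AmitsurIndex k M)
    (hS₂ : ∀ M, AmitsurIndex k M →
      ∃! M', M' ∈ S ∧ Multiset.Rel (fun w w' => w.IsRotated w') M M') :
    detLin k X = ∑ M ∈ S, (-1 : A) ^ (n + Multiset.card M) *
      ∏ w ∈ M.toFinset, sigmaCoeff n ((w.map X).prod) (M.count w) := by
  let B := MvPolynomial (Fin s × Fin n × Fin n) ℤ
  let φ : B →+* A := MvPolynomial.eval₂Hom (Int.castRingHom A) (fun p => X p.1 p.2.1 p.2.2)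
  let G : Fin s → Matrix (Fin n) (Fin n) B := fun r => Matrix.of fun i j => MvPolynomial.X (r, i, j)
  have hG : X = fun r => (G r).map φ := by
    funext r
    ext1 i j
    simp [G, φ, B]
  have h := congrArg φ (generic_case n s k hsum G S hS₁ hS₂)
  rw [← detLin_map, ← hG, map_sum] at h
  rw [h]
  refine Finset.sum_congr rfl fun M _ => ?_
  rw [map_mul, map_pow, map_neg, map_one, map_prod]
  congr 1
  refine Finset.prod_congr rfl fun w _ => ?_
  rw [← sigmaCoeff_map, ← words_map, ← hG]
end

section
/- Let n be an even positive integer and let Y, Z be n×n matrices over a commutative unital ring. Then P(Y)·P(Z) = Σ (−1)^{i_1(deg_Y c_1 + deg_Z c_1 + 1) + ⋯ + i_q(deg_Y c_q + deg_Z c_q + 1)} σ_{i_1}(c_1) ⋯ σ_{i_q}(c_q), where the sum ranges over all equivalence classes (up to cyclic permutation and reversal-with-transposition of each word) of multisets {{c_1 repeated i_1 times, …, c_q repeated i_q times}} such that: (i) c_1,…,c_q are primitive words in the letters Y, Y^t, Z, Z^t, pairwise different up to cyclic permutation and reversal-with-transposition; (ii) each word c_j is a product of two-letter blocks AB with A ∈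 {Y, Y^t} and B ∈ {Z, Z^t}; and (iii) i_1(deg_Y c_1 + deg_{Y^t} c_1) + ⋯ + i_q(deg_Y c_q + deg_{Y^t} c_q) = n/2 and i_1(deg_Z c_1 + deg_{Z^t} c_1) + ⋯ + i_q(deg_Z c_q + deg_{Z^t} c_q) = n/2. Here σ_i(c) is evaluated at the product of matrices given by the word c. In particular, the product of two pfaffians P(Y)·P(Z) is a polynomial with integer coefficients in the elements σ_k(h), h a product of Y, Y^t, Z, Z^t. -/
open scoped BigOperators

/-- Letters for words in `Y, Yᵗ, Z, Zᵗ`: the first component distinguishes `Y` (false)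
from `Z` (true), the second tells whether the letter is transposed. -/
abbrev PfLetter := Bool × Bool

/-- The matrix corresponding to a letter. -/
def letterMat {A : Type*} [CommRing A] {N : ℕ}
    (Y Z : Matrix (Fin N) (Fin N) A) (p : PfLetter) : Matrix (Fin N) (Fin N) A :=
  if p.2 then (if p.1 then Z.transpose else Y.transpose) else (if p.1 then Z else Y)

/-- Reversal-with-transposition of a word: `(a_1⋯a_r)ᵗ = a_rᵗ⋯a_1ᵗ`. -/
def wordTp (w : List PfLetter) : List PfLetter :=
  (w.map fun p => (p.1, !p.2)).reverse

/-- Equivalence of words up to cyclic permutation and reversal-with-transposition. -/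
def wordEqCT (w w' : List PfLetter) : Prop :=
  w.IsRotated w' ∨ w.IsRotated (wordTp w')

/-- The condition on a multiset `M` of words indexing a summand: members are primitive,
are products of blocks `AB` with `A ∈ {Y,Yᵗ}`, `B ∈ {Z,Zᵗ}`, members equivalent up to
cyclic permutation and reversal-with-transposition are equal, and the degree conditions
`Σ (mult w)·(deg_Y w + deg_{Yᵗ} w) = n/2 = Σ (mult w)·(deg_Z w + deg_{Zᵗ} w)` hold. -/
def PfIndex (k : ℕ) (M : Multiset (List PfLetter)) : Prop :=
  (∀ w ∈ M, PrimitiveWord w) ∧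
  (∀ w ∈ M, ∃ ps : List (Bool × Bool),
      w = (ps.map fun pr => [((false, pr.1) : PfLetter), (true, pr.2)]).flatten) ∧
  (∀ w ∈ M, ∀ w' ∈ M, wordEqCT w w' → w = w') ∧
  ((M.map fun w => w.countP fun p => p.1 = false).sum = k) ∧
  ((M.map fun w => w.countP fun p => p.1 = true).sum = k)

namespace PfW
open Equiv

/-- pair index equivalence -/
def pe (k : ℕ) : Fin k × Bool ≃ Fin (2 * k) where
  toFun p := ⟨2 * p.1 + (if p.2 then 1 else 0), by have := p.1.2; split_ifs <;> omega⟩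
  invFun x := (⟨x / 2, by omega⟩, decide (x.1 % 2 = 1))
  left_inv := by
    rintro ⟨⟨i, hi⟩, b⟩
    cases b <;> simp <;> omega
  right_inv := by
    rintro ⟨x, hx⟩
    apply Fin.ext
    by_cases h : x % 2 = 1 <;> simp [h] <;> omega

theorem pfCond_iff {k : ℕ} (π : Perm (Fin (2 * k))) :
    pfCond π ↔ (∀ i, π (pe k (i, false)) < π (pe k (i, true))) ∧
      StrictMono (fun i => π (pe k (i, false))) := by
  unfold pfCond
  constructor
  · rintro ⟨h1, h2⟩
    refine ⟨fun i => ?_, fun i j hij => ?_⟩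
    · simpa [pe] using h1 i (by have := i.2; omega)
    · simpa [pe] using h2 i j hij (by have := j.2; omega)
  · rintro ⟨h1, h2⟩
    refine ⟨fun i h => ?_, fun i j hij h => ?_⟩
    · simpa [pe] using h1 ⟨i, by omega⟩
    · simpa [pe] using @h2 ⟨i, by omega⟩ ⟨j, by omega⟩ hij

theorem pairProd_eq {A : Type*} [CommRing A] {k : ℕ} (X : Matrix (Fin (2 * k)) (Fin (2 * k)) A)
    (π : Perm (Fin (2 * k))) :
    pairProd X π = ∏ i : Fin k, X (π (pe k (i, false))) (π (pe k (i, true))) := by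
  unfold pairProd
  rw [show 2 * k / 2 = k by omega, ← Fin.prod_univ_eq_prod_range (fun i => if h : 2 * i + 1 < 2 * k then X (π ⟨2 * i, by omega⟩) (π ⟨2 * i + 1, h⟩) else 0)]
  apply Finset.prod_congr rfl
  intro i _
  have := i.2
  rw [dif_pos (by omega)]
  simp [pe]

/-- full sum -/
def fullPf {A : Type*} [CommRing A] {k : ℕ} (X : Matrix (Fin (2 * k)) (Fin (2 * k)) A) : A :=
  ∑ π : Perm (Fin (2 * k)), (Perm.sign π : ℤ) • pairProd X π

theorem fullPf_congr {A : Type*} [CommRing A] {k : ℕ} (P X : Matrix (Fin (2 * k)) (Fin (2 * k)) A) :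
    fullPf (P * X * P.transpose) = P.det * fullPf X := by
  have h1 : ∀ π : Perm (Fin (2 * k)), pairProd (P * X * P.transpose) π =
      ∑ f : Fin (2*k) → Fin (2*k),
        (∏ x, P (π x) (f x)) * ∏ i : Fin k, X (f (pe k (i, false))) (f (pe k (i, true))) := by
    intro π
    rw [pairProd_eq]
    have : ∀ a b, (P * X * P.transpose) a b = ∑ c : Bool → Fin (2*k),
        P a (c false) * P b (c true) * X (c false) (c true) := by
      intro a b
      rw [← (Equiv.boolArrowEquivProd (Fin (2*k))).symm.sum_comp]
      simp only [Matrix.mul_apply, Matrix.transpose_apply, Fintype.sum_prod_type, Finset.sum_mul]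
      rw [Finset.sum_comm]
      refine Finset.sum_congr rfl fun x _ => Finset.sum_congr rfl fun y _ => ?_
      simp [Equiv.boolArrowEquivProd]
      ring
    simp only [this]
    rw [Finset.prod_univ_sum]
    simp only [Fintype.piFinset_univ]
    let E : (Fin k → Bool → Fin (2*k)) ≃ (Fin (2*k) → Fin (2*k)) :=
      (Equiv.curry _ _ _).symm.trans (Equiv.arrowCongr (pe k) (Equiv.refl _))
    rw [← E.sum_comp]
    refine Finset.sum_congr rfl fun g _ => ?_
    have hE : ∀ i b, E g (pe k (i, b)) = g i b := by
      intro i b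
      simp [E, Equiv.arrowCongr, Equiv.curry]
    rw [← (pe k).prod_comp, Fintype.prod_prod_type, ← Finset.prod_mul_distrib]
    refine Finset.prod_congr rfl fun i _ => ?_
    simp [hE]
    ring
  unfold fullPf
  simp only [h1, Finset.smul_sum]
  rw [Finset.sum_comm]
  have h2 : ∀ f : Fin (2*k) → Fin (2*k), ∑ π : Perm (Fin (2 * k)), (Perm.sign π : ℤ) •
      ((∏ x, P (π x) (f x)) * ∏ i : Fin k, X (f (pe k (i, false))) (f (pe k (i, true)))) =
      (P.submatrix id f).det * ∏ i : Fin k, X (f (pe k (i, false))) (f (pe k (i, true))) := by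
    intro f
    rw [Matrix.det_apply, Finset.sum_mul]
    refine Finset.sum_congr rfl fun π _ => ?_
    simp [Units.smul_def, mul_assoc]
  simp only [h2, Finset.mul_sum]
  symm
  apply Finset.sum_of_injOn (fun π : Perm (Fin (2*k)) => (π : Fin (2*k) → Fin (2*k)))
  · intro a _ b _ h
    exact DFunLike.coe_injective h
  · intro _ _
    simp
  · intro f _ hf
    have : ¬ Function.Injective f := by
      intro hi
      apply hf
      refine ⟨Equiv.ofBijective f (Finite.injective_iff_bijective.1 hi), by simp, rfl⟩
    unfold Function.Injective at this
    push Not at this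
    obtain ⟨a, b, hab, hne⟩ := this
    rw [Matrix.det_zero_of_column_eq hne, zero_mul]
    intro i
    simp [hab]
  · intro π _
    simp only [Matrix.det_permute', pairProd_eq]
    simp
    ring

/-- the pair-preserving permutation -/
def hyp {k : ℕ} (q : Perm (Fin k)) (ε : Fin k → Bool) : Perm (Fin (2 * k)) :=
  (pe k).permCongr ((Equiv.prodCongrLeft (fun _ => q)).trans (Equiv.prodCongrRight (fun i => if ε (q.symm i) then Equiv.swap false true else 1)))

theorem hyp_apply {k : ℕ} (q : Perm (Fin k)) (ε : Fin k → Bool) (i b) :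
    hyp q ε (pe k (i, b)) = pe k (q i, b ^^ ε i) := by
  simp only [hyp, Equiv.permCongr_apply, Equiv.symm_apply_apply]
  cases b <;> cases h : ε i <;> simp [prodCongrLeft, prodCongrRight, h]

theorem hyp_sign {k : ℕ} (q : Perm (Fin k)) (ε : Fin k → Bool) :
    (Perm.sign (hyp q ε) : ℤ) = ∏ i, if ε i then -1 else 1 := by
  rw [hyp, Perm.sign_permCongr, Perm.sign_trans, Perm.sign_prodCongrLeft, Perm.sign_prodCongrRight]
  rw [← Equiv.prod_comp q (fun i => Perm.sign (if ε (q.symm i) then Equiv.swap false true else 1))]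
  simp only [Equiv.symm_apply_apply]
  simp
  refine Finset.prod_congr rfl fun i _ => ?_
  cases ε i <;> simp

theorem pairProd_hyp {A : Type*} [CommRing A] {k : ℕ} (X : Matrix (Fin (2 * k)) (Fin (2 * k)) A)
    (hX : X.transpose = -X) (π : Perm (Fin (2 * k))) (q : Perm (Fin k)) (ε : Fin k → Bool) :
    (Perm.sign (π * hyp q ε) : ℤ) • pairProd X (π * hyp q ε) = (Perm.sign π : ℤ) • pairProd X π := by
  have hX' : ∀ i j, X j i = - X i j := fun i j => by
    have := congrFun (congrFun hX i) j
    simpa using this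
  rw [Perm.sign_mul, Units.val_mul, hyp_sign, mul_smul]
  congr 1
  rw [pairProd_eq, pairProd_eq, ← Equiv.prod_comp q (fun i => X (π (pe k (i, false))) (π (pe k (i, true))))]
  rw [zsmul_eq_mul]
  rw [Int.cast_prod, ← Finset.prod_mul_distrib]
  refine Finset.prod_congr rfl fun i _ => ?_
  rw [Perm.mul_apply, Perm.mul_apply, hyp_apply, hyp_apply]
  cases ε i
  · simp
  · simp
    rw [hX', neg_neg]

theorem hyp_bij {k : ℕ} : Function.Bijective
    (fun x : {π : Perm (Fin (2*k)) // pfCond π} × (Perm (Fin k) × (Fin k → Bool)) =>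
      x.1.1 * hyp x.2.1 x.2.2) := by
  constructor
  · rintro ⟨⟨π, hπ⟩, q, ε⟩ ⟨⟨π', hπ'⟩, q', ε'⟩ h
    simp only at h
    rw [pfCond_iff] at hπ hπ'
    have h0 : ∀ i b, π (pe k (q i, b ^^ ε i)) = π' (pe k (q' i, b ^^ ε' i)) := by
      intro i b
      have := congrArg (fun σ : Perm (Fin (2*k)) => σ (pe k (i, b))) h
      simpa [hyp_apply] using this
    have he : ε = ε' := by
      funext i
      have h1 := h0 i false
      have h2 := h0 i true
      have h3 := hπ.1 (q i)
      have h4 := hπ'.1 (q' i)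
      cases h5 : ε i <;> cases h6 : ε' i <;> simp [h5, h6] at h1 h2 ⊢
      · rw [h1, h2] at h3; exact absurd h3 (by simpa using h4.le)
      · rw [h1, h2] at h3; exact absurd h3 (by simpa using h4.le)
    subst he
    have h0' : ∀ i b, π (pe k (q i, b)) = π' (pe k (q' i, b)) := by
      intro i b
      have := h0 i (b ^^ ε i)
      simpa using this
    have hm : (fun i => π (pe k (i, false))) = (fun i => π' (pe k (i, false))) := by
      rw [← StrictMono.range_inj hπ.2 hπ'.2]
      ext x
      constructor
      · rintro ⟨i, rfl⟩
        refine ⟨q' (q.symm i), ?_⟩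
        have := h0' (q.symm i) false
        simp at this ⊢
        exact this.symm
      · rintro ⟨i, rfl⟩
        refine ⟨q (q'.symm i), ?_⟩
        have := h0' (q'.symm i) false
        simp at this ⊢
        exact this
    have hq : q = q' := by
      ext1 i
      have h1 := h0' i false
      have h2 := congrFun hm (q i)
      rw [h1] at h2
      have := π'.injective h2
      simpa using this.symm
    subst hq
    have : π = π' := by
      ext1 x
      obtain ⟨⟨i, b⟩, rfl⟩ := (pe k).surjective x
      simpa using h0' (q.symm i) b
    subst this
    rfl
  · intro σ
    let m : Fin k → Fin (2*k) := fun i => min (σ (pe k (i, false))) (σ (pe k (i, true)))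
    let ε : Fin k → Bool := fun i => decide (σ (pe k (i, true)) < σ (pe k (i, false)))
    have hne : ∀ i, σ (pe k (i, false)) ≠ σ (pe k (i, true)) := by
      intro i h
      have := σ.injective h
      simp at this
    have hmε : ∀ i, m i = σ (pe k (i, ε i)) := by
      intro i
      by_cases h : σ (pe k (i, true)) < σ (pe k (i, false))
      · simp [m, ε, h, h.le]
      · simp [m, ε, h]; exact le_of_not_gt h
    have hmt : ∀ i, σ (pe k (i, ε i)) < σ (pe k (i, !ε i)) := by
      intro i
      by_cases h : σ (pe k (i, true)) < σ (pe k (i, false))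
      · simp [ε, h]
      · simp [ε, h]; exact lt_of_le_of_ne (le_of_not_gt h) (hne i)
    have hmi : Function.Injective m := by
      intro i j hij
      rw [hmε, hmε] at hij
      have := σ.injective hij
      simp at this
      exact this.1
    let s := Tuple.sort m
    have hs : StrictMono (m ∘ s) := (Tuple.monotone_sort m).strictMono_of_injective (hmi.comp s.injective)
    refine ⟨⟨⟨σ * (hyp s.symm ε)⁻¹, ?_⟩, s.symm, ε⟩, by simp⟩
    have key : ∀ i b, (σ * (hyp s.symm ε)⁻¹) (pe k (i, b)) = σ (pe k (s i, b ^^ ε (s i))) := by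
      intro i b
      have : (hyp s.symm ε) (pe k (s i, b ^^ ε (s i))) = pe k (i, b) := by
        rw [hyp_apply]; simp
      rw [← this]
      simp
    rw [pfCond_iff]
    simp only [key]
    refine ⟨fun i => by simpa using hmt (s i), fun i j hij => ?_⟩
    have := hs hij
    simpa [hmε] using this

theorem fullPf_eq {A : Type*} [CommRing A] {k : ℕ} (X : Matrix (Fin (2 * k)) (Fin (2 * k)) A)
    (hX : X.transpose = -X) :
    fullPf X = (Fintype.card (Perm (Fin k) × (Fin k → Bool)) : A) * pfaffian X := by
  classical
  unfold fullPf pfaffian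
  rw [← (Equiv.ofBijective _ (hyp_bij (k := k))).sum_comp]
  simp only [Equiv.ofBijective_apply]
  rw [Fintype.sum_prod_type]
  simp only [pairProd_hyp X hX]
  simp only [Finset.sum_const, Finset.card_univ]
  rw [← Finset.smul_sum, nsmul_eq_mul]
  congr 1
  symm
  apply Finset.sum_subtype
  simp

/-- standard symplectic matrix -/
def Jm (A : Type*) [CommRing A] (k : ℕ) : Matrix (Fin (2*k)) (Fin (2*k)) A := fun x y =>
  if ((pe k).symm x).1 = ((pe k).symm y).1 then
    (if ((pe k).symm x).2 then (if ((pe k).symm y).2 then 0 else -1)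
      else (if ((pe k).symm y).2 then 1 else 0)) else 0

theorem Jm_pe (A : Type*) [CommRing A] (k : ℕ) (i j b c) : Jm A k (pe k (i, b)) (pe k (j, c)) =
   if i = j then (if b then (if c then 0 else -1) else (if c then 1 else 0)) else 0 := by
  simp [Jm]

theorem Jm_transpose (A : Type*) [CommRing A] (k : ℕ) : (Jm A k).transpose = - Jm A k := by
  ext x y
  obtain ⟨⟨i, b⟩, rfl⟩ := (pe k).surjective x
  obtain ⟨⟨j, c⟩, rfl⟩ := (pe k).surjective y
  rw [Matrix.transpose_apply, Matrix.neg_apply, Jm_pe, Jm_pe]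
  by_cases h : i = j
  · subst h
    cases b <;> cases c <;> simp
  · simp [h, Ne.symm h]

theorem Jm_sq (A : Type*) [CommRing A] (k : ℕ) : Jm A k * Jm A k = -1 := by
  ext x y
  obtain ⟨⟨i, b⟩, rfl⟩ := (pe k).surjective x
  obtain ⟨⟨j, c⟩, rfl⟩ := (pe k).surjective y
  rw [Matrix.mul_apply, ← (pe k).sum_comp, Fintype.sum_prod_type, Matrix.neg_apply,
    Matrix.one_apply]
  simp only [Jm_pe]
  by_cases h : i = j
  · subst h
    cases b <;> cases c <;> simp
  · cases b <;> cases c <;> simp [h]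

theorem pf_Jm (A : Type*) [CommRing A] (k : ℕ) : pfaffian (Jm A k) = 1 := by
  classical
  unfold pfaffian
  rw [Finset.sum_eq_single 1]
  · rw [pairProd_eq]
    simp [Jm_pe]
  · intro π hπ hne
    simp only [Finset.mem_filter, Finset.mem_univ, true_and, pfCond_iff] at hπ
    rw [pairProd_eq]
    have : ∃ i, Jm A k (π (pe k (i, false))) (π (pe k (i, true))) = 0 := by
      by_contra! hcon
      apply hne
      have h1 : ∀ i, ∃ j, π (pe k (i, false)) = pe k (j, false) ∧ π (pe k (i, true)) = pe k (j, true) := by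
        intro i
        have h2 := hcon i
        have h3 := hπ.1 i
        obtain ⟨⟨a, b⟩, hab⟩ := (pe k).surjective (π (pe k (i, false)))
        obtain ⟨⟨a', b'⟩, hab'⟩ := (pe k).surjective (π (pe k (i, true)))
        rw [← hab, ← hab'] at h2 h3 ⊢
        rw [Jm_pe] at h2
        by_cases h : a = a'
        · subst h
          cases b <;> cases b' <;> simp at h2 ⊢
          simp [pe] at h3
        · simp [h] at h2
      choose q hq using h1
      have hqm : StrictMono q := by
        intro i j hij
        have := hπ.2 hij
        simp only [(hq _).1] at this
        simp [pe] at this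
        exact this
      have hq1 : ∀ i, q i = i := by
        have : q = id := by
          apply (StrictMono.range_inj hqm strictMono_id).1
          rw [Set.range_id, Set.range_eq_univ]
          exact Finite.injective_iff_surjective.1 hqm.injective
        intro i; rw [this]; rfl
      ext1 x
      obtain ⟨⟨i, b⟩, rfl⟩ := (pe k).surjective x
      cases b
      · rw [(hq i).1, hq1]; rfl
      · rw [(hq i).2, hq1]; rfl
    obtain ⟨i, hi⟩ := this
    rw [Finset.prod_eq_zero (Finset.mem_univ i) hi, smul_zero]
  · intro h
    exfalso
    apply h
    simp only [Finset.mem_filter, Finset.mem_univ, true_and, pfCond_iff]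
    refine ⟨fun i => by simp [pe], fun i j hij => by simpa [pe] using hij⟩
end PfW

namespace PfW
open Equiv

theorem exists_sympl {K : Type*} [Field K] (k : ℕ) : ∀ (V : Type*) [AddCommGroup V] [Module K V]
    [FiniteDimensional K V] (B : V →ₗ[K] V →ₗ[K] K) (_ : ∀ x, B x x = 0)
    (_ : ∀ x, (∀ y, B x y = 0) → x = 0) (_ : Module.finrank K V = 2 * k),
    ∃ b : Fin k → Bool → V, ∀ i j c d, B (b i c) (b j d) =
      if i = j then (if c then (if d then 0 else -1) else (if d then 1 else 0)) else 0 := by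
  induction k with
  | zero => intro V _ _ _ B _ _ _; exact ⟨fun i => i.elim0, fun i => i.elim0⟩
  | succ k ih =>
    intro V _ _ _ B halt hnd hr
    have hsk : ∀ x y, B x y = - B y x := by
      intro x y
      have := halt (x + y)
      simp [halt] at this
      linear_combination this
    obtain ⟨v, w, hvw⟩ : ∃ v w, B v w = 1 := by
      have : Nontrivial V := Module.nontrivial_of_finrank_pos (R := K) (by omega)
      obtain ⟨v, hv⟩ := exists_ne (0 : V)
      have : ∃ w, B v w ≠ 0 := by
        by_contra! h
        exact hv (hnd v h)
      obtain ⟨w, hw⟩ := this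
      exact ⟨v, (B v w)⁻¹ • w, by simp [hw]⟩
    have hwv : B w v = -1 := by rw [hsk, hvw]
    let φ : V →ₗ[K] K × K := (B v).prod (B w)
    let U := LinearMap.ker φ
    have hU : ∀ x ∈ U, B v x = 0 ∧ B w x = 0 := by
      intro x hx
      have : φ x = 0 := hx
      simpa [φ] using this
    have hU' : ∀ x, B v x = 0 → B w x = 0 → x ∈ U := by
      intro x h1 h2
      show φ x = 0
      simp [φ, h1, h2]
    have hsurj : Function.Surjective φ := by
      rintro ⟨a, b⟩
      refine ⟨a • w - b • v, ?_⟩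
      simp [φ, halt, hvw, hwv]
    have hrU : Module.finrank K U = 2 * k := by
      have := LinearMap.finrank_range_add_finrank_ker φ
      rw [LinearMap.range_eq_top.2 hsurj, finrank_top] at this
      simp at this
      change 2 + Module.finrank K U = _ at this
      omega
    obtain ⟨b, hb⟩ := ih U (B.domRestrict₁₂ U U) (fun x => halt x) (by
      intro x hx
      apply Subtype.ext
      apply hnd
      intro y
      have h1 : y + (B w y) • v - (B v y) • w ∈ U := by
        apply hU' <;> simp [halt, hvw, hwv]
      have h2 : B x (y + (B w y) • v - (B v y) • w) = 0 := hx ⟨_, h1⟩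
      have h3 := hU x x.2
      simp at h2
      rw [hsk (x:V) v, hsk (x:V) w, h3.1, h3.2] at h2
      simpa using h2) hrU
    refine ⟨Fin.cons (fun c => if c then w else v) (fun i c => (b i c : V)), ?_⟩
    intro i j c d
    refine Fin.cases ?_ (fun i => ?_) i <;> refine Fin.cases ?_ (fun j => ?_) j
    · cases c <;> cases d <;> simp [halt, hvw, hwv]
    · have h3 := hU _ (b j d).2
      rw [if_neg (Fin.succ_ne_zero j).symm]
      cases c <;> simp [h3]
    · have h3 := hU _ (b i c).2
      rw [if_neg (Fin.succ_ne_zero i), hsk]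
      cases d <;> simp [h3]
    · have := hb i j c d
      simp only [Fin.cons_succ, Fin.succ_inj]
      rw [← this]
      rfl

theorem det_Jm (A : Type*) [CommRing A] (k : ℕ) : (Jm A k).det = 1 := by
  let e : Fin (2*k) ≃ Fin 2 × Fin k :=
    (pe k).symm.trans ((Equiv.prodComm _ _).trans (Equiv.prodCongr finTwoEquiv.symm (Equiv.refl _)))
  have : Jm A k = (Matrix.blockDiagonal (fun _ : Fin k => !![(0:A), 1; -1, 0])).submatrix e e := by
    ext x y
    obtain ⟨⟨i, c⟩, rfl⟩ := (pe k).surjective x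
    obtain ⟨⟨j, d⟩, rfl⟩ := (pe k).surjective y
    rw [Jm_pe]
    by_cases h : i = j
    · cases c <;> cases d <;> simp [e, h, Matrix.blockDiagonal_apply, finTwoEquiv]
    · cases c <;> cases d <;> simp [e, h, Matrix.blockDiagonal_apply]
  rw [this, Matrix.det_submatrix_equiv_self, Matrix.det_blockDiagonal]
  simp [Matrix.det_fin_two]

theorem pf_sq_field {K : Type*} [Field K] [CharZero K] {k : ℕ}
    (X : Matrix (Fin (2 * k)) (Fin (2 * k)) K)
    (hX : X.transpose = -X) (hd : X.det ≠ 0) : pfaffian X ^ 2 = X.det := by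
  have hX' : ∀ i j, X j i = - X i j := fun i j => by
    have := congrFun (congrFun hX i) j
    simpa using this
  let B : (Fin (2*k) → K) →ₗ[K] (Fin (2*k) → K) →ₗ[K] K := Matrix.toLinearMap₂' K X
  have hB : ∀ x y, B x y = x ⬝ᵥ X.mulVec y := fun x y => Matrix.toLinearMap₂'_apply' X x y
  obtain ⟨b, hb⟩ := exists_sympl k (Fin (2*k) → K) B (by
    intro x
    have h1 : B x x = - B x x := by
      conv_lhs => rw [hB, Matrix.dotProduct_mulVec, ← Matrix.mulVec_transpose, hX, Matrix.neg_mulVec, neg_dotProduct, dotProduct_comm, ← hB]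
    exact self_eq_neg.1 h1) (by
    intro x h
    have : Matrix.mulVec X.transpose x = 0 := by
      apply dotProduct_eq
      intro y
      rw [Matrix.mulVec_transpose, ← Matrix.dotProduct_mulVec, ← hB, h, zero_dotProduct]
    refine Matrix.eq_zero_of_mulVec_eq_zero (by simpa using hd) this) (by simp)
  let P : Matrix (Fin (2*k)) (Fin (2*k)) K := fun x => b ((pe k).symm x).1 ((pe k).symm x).2
  have hP : P * X * P.transpose = Jm K k := by
    ext x y
    obtain ⟨⟨i, c⟩, rfl⟩ := (pe k).surjective x
    obtain ⟨⟨j, d⟩, rfl⟩ := (pe k).surjective y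
    rw [Jm_pe, ← hb, hB, Matrix.dotProduct_mulVec, Matrix.mul_apply]
    have hPP : ∀ i c x, P (pe k (i, c)) x = b i c x := fun i c x => by simp [P]
    simp only [dotProduct, Matrix.vecMul, Matrix.mul_apply, Matrix.transpose_apply, hPP]
  have h1 := fullPf_congr P X
  rw [hP, fullPf_eq _ hX, fullPf_eq _ (Jm_transpose K k), pf_Jm] at h1
  set c : K := (Fintype.card (Perm (Fin k) × (Fin k → Bool)) : K)
  have hc : c ≠ 0 := Nat.cast_ne_zero.2 Fintype.card_ne_zero
  have h2 : P.det * pfaffian X = 1 := by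
    apply mul_left_cancel₀ hc
    linear_combination -h1
  have h3 : P.det ^ 2 * X.det = (Jm K k).det := by
    rw [← hP]; simp; ring
  rw [det_Jm] at h3
  have hPd : P.det ≠ 0 := left_ne_zero_of_mul (h2.trans_ne one_ne_zero)
  apply mul_left_cancel₀ (pow_ne_zero 2 hPd)
  rw [h3, ← mul_pow, h2, one_pow]

theorem pf_map {A B : Type*} [CommRing A] [CommRing B] (f : A →+* B) {k : ℕ}
    (X : Matrix (Fin (2 * k)) (Fin (2 * k)) A) : pfaffian (X.map f) = f (pfaffian X) := by
  simp only [pfaffian, map_sum, pairProd_eq, map_zsmul, map_prod, Matrix.map_apply]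

theorem pf_sq {D : Type*} [CommRing D] [IsDomain D] [CharZero D] {k : ℕ}
    (X : Matrix (Fin (2 * k)) (Fin (2 * k)) D)
    (hX : X.transpose = -X) (hd : X.det ≠ 0) : pfaffian X ^ 2 = X.det := by
  have hinj := IsFractionRing.injective D (FractionRing D)
  have : CharZero (FractionRing D) := charZero_of_injective_algebraMap hinj
  apply hinj
  have := pf_sq_field (X.map (algebraMap D (FractionRing D))) (by
    rw [← Matrix.transpose_map, hX]
    ext; simp) (by
    rw [← RingHom.mapMatrix_apply, ← RingHom.map_det]
    simpa using hd)
  rw [← RingHom.mapMatrix_apply, ← RingHom.map_det, RingHom.mapMatrix_apply, pf_map] at this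
  rw [← this, map_pow]
end PfW

namespace PfW
open Equiv PowerSeries

theorem deriv_prod {S : Type*} [CommRing S] {R : Type*} [CommRing R] [Algebra R S]
   (d : Derivation R S S) {ι : Type*} [DecidableEq ι] (s : Finset ι) (f : ι → S) :
   d (∏ i ∈ s, f i) = ∑ i ∈ s, d (f i) * ∏ j ∈ s.erase i, f j := by
  induction s using Finset.induction_on with
  | empty => simp
  | insert a s ha ih =>
    rw [Finset.prod_insert ha, Derivation.leibniz, ih, Finset.sum_insert ha, Finset.erase_insert ha]
    simp only [smul_eq_mul]
    rw [add_comm, Finset.mul_sum]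
    congr 1
    · ring
    · refine Finset.sum_congr rfl fun i hi => ?_
      have : i ≠ a := fun h => ha (h ▸ hi)
      rw [Finset.erase_insert_of_ne this.symm, Finset.prod_insert (by simp [ha])]
      ring

theorem deriv_det {S : Type*} [CommRing S] {R : Type*} [CommRing R] [Algebra R S]
   (d : Derivation R S S) {ι : Type*} [DecidableEq ι] [Fintype ι] (N : Matrix ι ι S) :
   d N.det = (N.adjugate * N.map d).trace := by
  have h : ∀ i, (N.adjugate * N.map d) i i = (N.updateCol i (fun j => d (N j i))).det := by
    intro i
    rw [← Matrix.cramer_apply, Matrix.cramer_eq_adjugate_mulVec]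
    simp [Matrix.mul_apply, Matrix.mulVec, dotProduct]
  simp only [Matrix.trace, Matrix.diag, h]
  simp only [Matrix.det_apply, map_sum, Units.smul_def, map_zsmul, deriv_prod, Finset.smul_sum]
  rw [Finset.sum_comm]
  refine Finset.sum_congr rfl fun i _ => Finset.sum_congr rfl fun σ _ => ?_
  rw [← Finset.mul_prod_erase _ _ (Finset.mem_univ i)]
  congr 2
  · simp
  · refine Finset.prod_congr rfl fun j hj => ?_
    rw [Matrix.updateCol_ne (Finset.ne_of_mem_erase hj)]

variable {D : Type*} [CommRing D] {n : Type*} [DecidableEq n] [Fintype n]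

/-- `det(1 - t^l M)` -/
noncomputable def psdet (l : ℕ) (M : Matrix n n D) : D⟦X⟧ :=
  (1 - (X ^ l : D⟦X⟧) • M.map (C (R := D))).det

/-- power sums -/
noncomputable def psum (l : ℕ) (M : Matrix n n D) : D⟦X⟧ :=
  PowerSeries.mk fun j => if l ∣ j ∧ j ≠ 0 then (M ^ (j / l)).trace else 0

theorem psdet_newton (l : ℕ) (hl : 0 < l) (M : Matrix n n D) :
    X * d⁄dX D (psdet l M) = - psdet l M * ((l : D⟦X⟧) * psum l M) := by
  set N : Matrix n n D⟦X⟧ := 1 - (X ^ l : D⟦X⟧) • M.map (C (R := D)) with hN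
  let G : Matrix n n D⟦X⟧ := Matrix.of fun i j => PowerSeries.mk fun a => if l ∣ a then (M ^ (a / l)) i j else 0
  have hG : ∀ i j, G i j = PowerSeries.mk fun a => if l ∣ a then (M ^ (a / l)) i j else 0 := fun i j => rfl
  have hdet : psdet l M = N.det := rfl
  have hNG : N * G = 1 := by
    rw [hN, sub_mul, one_mul, Matrix.smul_mul]
    ext i j a
    have h1 : (M.map (C (R := D)) * G) i j = PowerSeries.mk fun a => if l ∣ a then (M ^ (a / l + 1)) i j else 0 := by
      ext a
      simp only [Matrix.mul_apply, map_sum, Matrix.map_apply, hG, coeff_C_mul, coeff_mk, pow_succ']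
      split_ifs <;> simp
    rw [Matrix.sub_apply, Matrix.smul_apply, h1, map_sub, smul_eq_mul, coeff_X_pow_mul']
    simp only [hG, coeff_mk]
    have h2 : (PowerSeries.coeff a) ((1 : Matrix n n D⟦X⟧) i j) = if a = 0 then (1 : Matrix n n D) i j else 0 := by
      by_cases hij : i = j
      · subst hij; simp [coeff_one]
      · simp [hij]
    rw [h2]
    by_cases ha : a = 0
    · subst ha; simp [hl.ne']
    · rw [if_neg ha]
      by_cases hla : l ∣ a
      · have hle : l ≤ a := Nat.le_of_dvd (Nat.pos_of_ne_zero ha) hla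
        have h3 : l ∣ a - l := Nat.dvd_sub hla (dvd_refl l)
        rw [if_pos hla, if_pos hle, if_pos h3]
        have h4 : a / l = (a - l) / l + 1 := by
          rw [← Nat.add_div_right _ hl, Nat.sub_add_cancel hle]
        rw [h4, sub_self]
      · rw [if_neg hla]
        by_cases hle : l ≤ a
        · have h3 : ¬ l ∣ a - l := fun h => hla ((Nat.dvd_sub_iff_left hle (dvd_refl l)).1 h)
          simp [h3]
        · simp [hle]
  have hadj : N.adjugate = N.det • G := by
    calc N.adjugate = N.adjugate * (N * G) := by rw [hNG, mul_one]
      _ = _ := by rw [← mul_assoc, Matrix.adjugate_mul, Matrix.smul_mul, one_mul]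
  have hdN : (X : D⟦X⟧) • N.map (d⁄dX D) = (l : D⟦X⟧) • (N - 1) := by
    ext1 i j
    have h5 : d⁄dX D ((1 : Matrix n n D⟦X⟧) i j) = 0 := by
      by_cases hij : i = j
      · subst hij; simp
      · simp [hij]
    simp only [hN, Matrix.smul_apply, Matrix.map_apply, Matrix.sub_apply, map_sub, smul_eq_mul, h5]
    rw [Derivation.leibniz, Derivation.leibniz_pow]
    simp
    obtain ⟨l, rfl⟩ : ∃ l', l = l' + 1 := ⟨l - 1, by omega⟩
    simp
    ring
  have htr : G.trace = (Fintype.card n : D⟦X⟧) + psum l M := by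
    ext a
    simp only [Matrix.trace, Matrix.diag, map_sum, hG, coeff_mk, psum, map_add]
    rw [show ((Fintype.card n : D⟦X⟧)) = C (R := D) (Fintype.card n : D) by simp, coeff_C]
    by_cases ha : a = 0
    · subst ha; simp
    · by_cases hla : l ∣ a <;> simp [ha, hla]
  rw [hdet, deriv_det, ← smul_eq_mul, ← Matrix.trace_smul, ← Matrix.mul_smul, hdN, Matrix.mul_smul,
    mul_sub, Matrix.adjugate_mul, mul_one, hadj, Matrix.trace_smul, Matrix.trace_sub,
    Matrix.trace_smul, Matrix.trace_smul, htr, Matrix.trace_one]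
  simp only [smul_eq_mul]
  ring

theorem psdet_const (l : ℕ) (hl : 0 < l) (M : Matrix n n D) : constantCoeff (psdet l M) = 1 := by
  rw [psdet, RingHom.map_det]
  have : (constantCoeff (R := D)).mapMatrix (1 - (X ^ l : D⟦X⟧) • M.map (C (R := D))) = 1 := by
    ext i j
    by_cases hij : i = j
    · subst hij; simp [hl.ne']
    · simp [hij, hl.ne']
  rw [this, Matrix.det_one]

theorem psdet_coeff (l : ℕ) (hl : 0 < l) (s : D) (M : Matrix n n D) (j : ℕ) :
    coeff j (psdet l (s • M)) = if l ∣ j then s ^ (j / l) * M.charpolyRev.coeff (j / l) else 0 := by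
  have h1 : psdet l (s • M) = Polynomial.eval₂RingHom (C (R := D)) (C s * X ^ l) M.charpolyRev := by
    rw [Matrix.charpolyRev, RingHom.map_det, psdet]
    congr 1
    ext1 i j
    by_cases hij : i = j
    · subst hij; simp; ring
    · simp [hij]; ring
  rw [h1, Polynomial.coe_eval₂RingHom, Polynomial.eval₂_eq_sum, Polynomial.sum, map_sum]
  have h2 : ∀ a, coeff j ((C (R := D)) (M.charpolyRev.coeff a) * (C s * X ^ l) ^ a) =
      if j = l * a then s ^ a * M.charpolyRev.coeff a else 0 := by
    intro a
    rw [mul_pow, ← map_pow, ← mul_assoc, ← map_mul, ← pow_mul, coeff_C_mul, coeff_X_pow]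
    split_ifs <;> simp [mul_comm]
  simp only [h2]
  by_cases h : l ∣ j
  · obtain ⟨c, rfl⟩ := h
    simp only [Nat.mul_right_inj hl.ne', dvd_mul_right, if_true, Nat.mul_div_cancel_left _ hl]
    rw [Finset.sum_ite_eq]
    split_ifs with h3
    · rfl
    · simp at h3; simp [h3]
  · rw [if_neg h]
    apply Finset.sum_eq_zero
    intro a _
    rw [if_neg]
    rintro rfl
    exact h (dvd_mul_right _ _)

theorem charpolyRev_coeff (M : Matrix n n D) (c : ℕ) (hc : c ≤ Fintype.card n) :
    M.charpolyRev.coeff c = M.charpoly.coeff (Fintype.card n - c) := by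
  nontriviality D
  rw [← Matrix.reverse_charpoly, Polynomial.coeff_reverse, Matrix.charpoly_natDegree_eq_dim, Polynomial.revAt_le hc]

/-- uniqueness from logarithmic derivatives -/
theorem log_unique [IsDomain D] [CharZero D] (k : ℕ) (f g p q : D⟦X⟧)
    (hf : X * d⁄dX D f = - f * p) (hg : X * d⁄dX D g = - g * q)
    (hf0 : constantCoeff f = 1) (hg0 : constantCoeff g = 1)
    (hp0 : constantCoeff p = 0) (hq0 : constantCoeff q = 0)
    (hpq : ∀ j ≤ k, coeff j p = coeff j q) : ∀ j ≤ k, coeff j f = coeff j g := by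
  have key : ∀ f p : D⟦X⟧, X * d⁄dX D f = - f * p → ∀ j : ℕ, (j : D) * coeff j f = - ∑ x ∈ Finset.HasAntidiagonal.antidiagonal j, coeff x.1 f * coeff x.2 p := by
    intro f p h j
    have := congrArg (coeff j) h
    rw [neg_mul, map_neg, coeff_mul _ f] at this
    rw [← this]
    cases j with
    | zero => simp
    | succ j => rw [coeff_succ_X_mul, coeff_derivative]; push_cast; ring
  intro j
  induction j using Nat.strong_induction_on with
  | _ j ih =>
    intro hj
    by_cases h0 : j = 0
    · subst h0; simpa using hf0.trans hg0.symm
    · have h1 := key f p hf j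
      have h2 := key g q hg j
      have h3 : (j : D) ≠ 0 := Nat.cast_ne_zero.2 h0
      apply mul_left_cancel₀ h3
      rw [h1, h2]
      congr 1
      refine Finset.sum_congr rfl fun x hx => ?_
      rw [Finset.HasAntidiagonal.mem_antidiagonal] at hx
      by_cases hx2 : x.2 = 0
      · rw [hx2]; simp [hp0, hq0]
      · rw [ih x.1 (by omega) (by omega), hpq x.2 (by omega)]
end PfW

namespace PfW

section words
variable {α : Type*}

/-- word power -/
def wpow (u : List α) (r : ℕ) : List α := (List.replicate r u).flatten

@[simp] theorem wpow_zero (u : List α) : wpow u 0 = [] := rfl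
theorem wpow_succ (u : List α) (r : ℕ) : wpow u (r+1) = u ++ wpow u r := by
  simp [wpow, List.replicate_succ]
theorem wpow_add (u : List α) (r s : ℕ) : wpow u (r+s) = wpow u r ++ wpow u s := by
  simp only [wpow, List.replicate_add, List.flatten_append]
@[simp] theorem wpow_one (u : List α) : wpow u 1 = u := by simp [wpow]
theorem wpow_succ' (u : List α) (r : ℕ) : wpow u (r+1) = wpow u r ++ u := by
  rw [wpow_add, wpow_one]
@[simp] theorem length_wpow (u : List α) (r : ℕ) : (wpow u r).length = r * u.length := by
  simp [wpow]
theorem wpow_mul (u : List α) (r s : ℕ) : wpow u (r*s) = wpow (wpow u r) s := by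
  induction s with
  | zero => simp
  | succ s ih => rw [Nat.mul_succ, wpow_add, ih, wpow_succ']
theorem wpow_conj (x y : List α) (r : ℕ) : wpow (x ++ y) r ++ x = x ++ wpow (y ++ x) r := by
  induction r with
  | zero => simp
  | succ r ih => rw [wpow_succ, wpow_succ, List.append_assoc, ih]; simp
@[simp] theorem wpow_nil (r : ℕ) : wpow ([] : List α) r = [] := by
  apply List.eq_nil_of_length_eq_zero; simp

theorem comm_pow : ∀ (N : ℕ) (a b : List α), a.length + b.length ≤ N → a ++ b = b ++ a →
    ∃ z i j, a = wpow z i ∧ b = wpow z j := by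
  intro N
  induction N with
  | zero =>
    intro a b hN _
    have ha : a = [] := List.eq_nil_of_length_eq_zero (by omega)
    have hb : b = [] := List.eq_nil_of_length_eq_zero (by omega)
    exact ⟨[], 0, 0, ha, hb⟩
  | succ N ih =>
    have main : ∀ a b : List α, a.length ≤ b.length → a.length + b.length ≤ N + 1 → a ++ b = b ++ a →
        ∃ z i j, a = wpow z i ∧ b = wpow z j := by
      intro a b hab hN h
      by_cases ha : a = []
      · exact ⟨b, 0, 1, ha, by simp⟩
      · have hpre : a <+: b := List.prefix_of_prefix_length_le (⟨b, rfl⟩ : a <+: a ++ b) (h ▸ ⟨a, rfl⟩) hab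
        obtain ⟨c, rfl⟩ := hpre
        have hpos := List.length_pos_of_ne_nil ha
        simp at hN
        obtain ⟨z, i, j, h1, h2⟩ := ih a c (by omega) (by
          rw [List.append_assoc] at h
          exact List.append_cancel_left h)
        exact ⟨z, i, i + j, h1, by rw [wpow_add, ← h1, ← h2]⟩
    intro a b hN h
    rcases le_total a.length b.length with hab | hab
    · exact main a b hab hN h
    · obtain ⟨z, i, j, h1, h2⟩ := main b a hab (by omega) h.symm
      exact ⟨z, j, i, h2, h1⟩

theorem prim_pow {u z : List α} (hu : PrimitiveWord u) {i : ℕ} (h : u = wpow z i) : u = z := by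
  rcases Nat.lt_or_ge i 2 with hi | hi
  · interval_cases i
    · exact absurd h hu.1
    · simpa using h
  · exact absurd h (hu.2 z i hi)

theorem wpow_comm (u : List α) (d : ℕ) : u ++ wpow u d = wpow u d ++ u := by
  rw [← wpow_succ, wpow_succ']

theorem root_unique {u v : List α} (hu : PrimitiveWord u) (hv : PrimitiveWord v) {d e : ℕ}
    (hd : 0 < d) (he : 0 < e) (h : wpow u d = wpow v e) : u = v := by
  have h1 := wpow_comm u d
  have h2 := wpow_comm v e
  rw [← h] at h2
  set x := wpow u d with hx
  have hlu : u.length ≤ x.length := by rw [hx, length_wpow]; exact Nat.le_mul_of_pos_left _ hd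
  have hlv : v.length ≤ x.length := by rw [h, length_wpow]; exact Nat.le_mul_of_pos_left _ he
  have key : ∀ a b : List α, a ++ x = x ++ a → b ++ x = x ++ b → a.length ≤ x.length → b.length ≤ x.length →
      a ++ b = (x ++ x).take (a.length + b.length) := by
    intro a b ha hb hal hbl
    have : (a ++ b) ++ (x ++ x) = (x ++ x) ++ (a ++ b) := by
      calc (a ++ b) ++ (x ++ x) = a ++ (b ++ x) ++ x := by simp
        _ = (a ++ x) ++ (b ++ x) := by rw [hb]; simp only [List.append_assoc]; rw [hb]
        _ = x ++ (a ++ x) ++ b := by rw [ha, hb]; simp only [List.append_assoc]; rw [← List.append_assoc a x b, ha]; simp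
        _ = _ := by rw [ha]; simp
    have h3 := congrArg (List.take (a.length + b.length)) this
    rw [List.take_append_of_le_length (l₁ := x ++ x) (by simp; omega)] at h3
    rw [← h3, List.take_append_of_le_length (by simp), List.take_of_length_le (by simp)]
  have hc : u ++ v = v ++ u := by
    rw [key u v h1 h2 hlu hlv, key v u h2 h1 hlv hlu, add_comm]
  obtain ⟨z, i, j, h3, h4⟩ := comm_pow _ u v le_rfl hc
  rw [prim_pow hu h3, prim_pow hv h4]

theorem exists_root : ∀ (N : ℕ) (w : List α), w.length ≤ N → w ≠ [] → ∃ u d, 0 < d ∧ PrimitiveWord u ∧ w = wpow u d := by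
  intro N
  induction N with
  | zero => intro w h1 h2; exact absurd (List.eq_nil_of_length_eq_zero (by omega)) h2
  | succ N ih =>
    intro w h1 h2
    by_cases hp : PrimitiveWord w
    · exact ⟨w, 1, one_pos, hp, by simp⟩
    · have : ∃ u r, 2 ≤ r ∧ w = wpow u r := by
        by_contra! hcon
        exact hp ⟨h2, hcon⟩
      obtain ⟨u, r, hr, rfl⟩ := this
      have hu : u ≠ [] := by rintro rfl; simp at h2
      have hpos := List.length_pos_of_ne_nil hu
      rw [length_wpow] at h1
      obtain ⟨v, d, hd, hv, rfl⟩ := ih u (by nlinarith) hu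
      exact ⟨v, d * r, by positivity, hv, by rw [wpow_mul]⟩

theorem rotate_split (w : List α) (i : ℕ) : ∃ x y, w = x ++ y ∧ w.rotate i = y ++ x := by
  refine ⟨w.take (i % w.length), w.drop (i % w.length), by simp, ?_⟩
  rw [List.rotate_eq_drop_append_take_mod]

theorem prim_conj {x y : List α} (h : PrimitiveWord (x ++ y)) : PrimitiveWord (y ++ x) := by
  refine ⟨fun h0 => h.1 (by simp at h0; simp [h0]), fun z r hr hz => ?_⟩
  change y ++ x = wpow z r at hz
  -- rotating z^r
  have hrot : (x ++ y) = (wpow z r).rotate y.length := by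
    rw [← hz, List.rotate_append_length_eq]
  have : ∀ i, ∃ z', (wpow z r).rotate i = wpow z' r := by
    intro i
    induction i with
    | zero => exact ⟨z, by simp⟩
    | succ i ih =>
      obtain ⟨z', hz'⟩ := ih
      rw [← List.rotate_rotate, hz']
      cases z' with
      | nil => exact ⟨[], by simp⟩
      | cons a t =>
        obtain ⟨r, rfl⟩ : ∃ r', r = r' + 1 := ⟨r - 1, by omega⟩
        refine ⟨t ++ [a], ?_⟩
        rw [wpow_succ, List.cons_append, List.rotate_cons_succ, List.rotate_zero]
        have := wpow_conj [a] t r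
        simp only [List.singleton_append] at this
        rw [wpow_succ, List.append_assoc, this]
        simp
  obtain ⟨z', hz'⟩ := this y.length
  rw [hz'] at hrot
  exact h.2 z' r hr hrot

theorem prim_rotate {w : List α} (h : PrimitiveWord w) (i : ℕ) : PrimitiveWord (w.rotate i) := by
  obtain ⟨x, y, h1, h2⟩ := rotate_split w i
  rw [h2]
  rw [h1] at h
  exact prim_conj h

theorem prim_rotate_inj {w : List α} (h : PrimitiveWord w) {i j : ℕ} (hi : i < w.length) (hj : j < w.length)
    (hij : w.rotate i = w.rotate j) : i = j := by
  have main : ∀ i j, i < j → j < w.length → w.rotate i = w.rotate j → False := by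
    intro i j hlt hj hij
    have h1 : w.rotate (j - i) = w := by
      have : (w.rotate (j - i)).rotate i = w.rotate i := by
        rw [List.rotate_rotate, hij]; congr 1; omega
      exact List.rotate_injective i this
    rw [List.rotate_eq_drop_append_take (by omega)] at h1
    have h2 : w.take (j - i) ++ w.drop (j - i) = w.drop (j - i) ++ w.take (j - i) := by
      rw [h1, List.take_append_drop]
    obtain ⟨z, a, b, ha, hb⟩ := comm_pow _ _ _ le_rfl h2
    have h3 : w = wpow z (a + b) := by rw [wpow_add, ← ha, ← hb, List.take_append_drop]
    have h4 : a ≠ 0 := by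
      rintro rfl
      have := congrArg List.length ha
      simp only [List.length_take, wpow_zero, List.length_nil] at this
      omega
    have h5 : b ≠ 0 := by
      rintro rfl
      have := congrArg List.length hb
      simp only [List.length_drop, wpow_zero, List.length_nil] at this
      omega
    exact h.2 z (a + b) (by omega) h3
  rcases lt_trichotomy i j with h1 | h1 | h1
  · exact (main i j h1 hj hij).elim
  · exact h1
  · exact (main j i h1 hi hij.symm).elim

end words

/-- letter transposition -/
def ltp (p : PfLetter) : PfLetter := (p.1, !p.2)

theorem wordTp_eq (w) : wordTp w = (w.map ltp).reverse := rfl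
@[simp] theorem wordTp_wordTp (w) : wordTp (wordTp w) = w := by
  simp only [wordTp, List.map_reverse, List.reverse_reverse, List.map_map]
  convert List.map_id w
  funext p
  simp
@[simp] theorem length_wordTp (w) : (wordTp w).length = w.length := by simp [wordTp]
theorem wordTp_append (a b) : wordTp (a ++ b) = wordTp b ++ wordTp a := by simp [wordTp]
theorem wordTp_wpow (a) (r : ℕ) : wordTp (wpow a r) = wpow (wordTp a) r := by
  induction r with
  | zero => rfl
  | succ r ih => rw [wpow_succ, wordTp_append, ih, wpow_succ']
theorem prim_wordTp {w : List PfLetter} (h : PrimitiveWord w) : PrimitiveWord (wordTp w) := by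
  refine ⟨fun h0 => h.1 ?_, fun z r hr hz => ?_⟩
  · have := congrArg List.length h0
    simp at this
    exact this
  · apply h.2 (wordTp z) r hr
    change wordTp w = wpow z r at hz
    change w = wpow (wordTp z) r
    rw [← wordTp_wpow, ← hz, wordTp_wordTp]
theorem wordTp_rotated {a b : List PfLetter} (h : a.IsRotated b) : (wordTp a).IsRotated (wordTp b) := by
  exact (h.map ltp).reverse

theorem ct_refl (a) : wordEqCT a a := Or.inl (List.IsRotated.refl a)
theorem ct_symm {a b} (h : wordEqCT a b) : wordEqCT b a := by
  rcases h with h | h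
  · exact Or.inl h.symm
  · right
    have := wordTp_rotated h
    rw [wordTp_wordTp] at this
    exact this.symm
theorem ct_trans {a b c} (h : wordEqCT a b) (h' : wordEqCT b c) : wordEqCT a c := by
  rcases h with h | h <;> rcases h' with h' | h'
  · exact Or.inl (h.trans h')
  · exact Or.inr (h.trans h')
  · exact Or.inr (h.trans (wordTp_rotated h'))
  · left
    have := wordTp_rotated h'
    rw [wordTp_wordTp] at this
    exact h.trans this
theorem ct_length {a b} (h : wordEqCT a b) : a.length = b.length := by
  rcases h with h | h
  · exact h.perm.length_eq
  · simpa using h.perm.length_eq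

/-- alternating words -/
def altP : Bool → List PfLetter → Prop
  | _, [] => True
  | b, p :: w => p.1 = b ∧ altP (!b) w

theorem altP_append (b : Bool) (u v) : altP b (u ++ v) ↔ altP b u ∧ altP (b ^^ decide (u.length % 2 = 1)) v := by
  induction u generalizing b with
  | nil => simp [altP]
  | cons p u ih =>
    simp only [List.cons_append, altP, ih, and_assoc, List.length_cons]
    rcases Nat.mod_two_eq_zero_or_one u.length with h | h
    · have : (u.length + 1) % 2 = 1 := by omega
      simp [h, this]
    · have : (u.length + 1) % 2 = 0 := by omega
      simp [h, this]

theorem altP_unique {b c : Bool} {u} (hu : u ≠ []) (hb : altP b u) (hc : altP c u) : b = c := by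
  cases u with
  | nil => exact absurd rfl hu
  | cons p u => exact hb.1.symm.trans hc.1

theorem altP_rotate {b : Bool} {w} (he : w.length % 2 = 0) (h : altP b w) (i : ℕ) :
    altP (b ^^ decide (i % 2 = 1)) (w.rotate i) := by
  induction i with
  | zero => simpa using h
  | succ i ih =>
    rw [← List.rotate_rotate]
    have h1 : (w.rotate i).length % 2 = 0 := by simpa using he
    generalize w.rotate i = v at ih h1
    cases v with
    | nil => simp [altP]
    | cons p v =>
      simp only [List.rotate_cons_succ, List.rotate_zero]
      rw [altP_append]
      simp only [List.length_cons] at h1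
      have h2 : v.length % 2 = 1 := by omega
      have h3 : decide ((i + 1) % 2 = 1) = !decide (i % 2 = 1) := by
        rcases Nat.mod_two_eq_zero_or_one i with h | h <;> simp [h] <;> omega
      simp only [h3, h2]
      obtain ⟨h4, h5⟩ := ih
      cases b <;> cases hd : decide (i % 2 = 1) <;> simp [hd, altP] at h4 h5 ⊢ <;> exact ⟨h5, h4⟩

theorem altP_wordTp {b : Bool} {w} (h : altP b w) : altP (b ^^ decide (w.length % 2 = 0)) (wordTp w) := by
  induction w generalizing b with
  | nil => simp [wordTp, altP]
  | cons p w ih =>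
    have : wordTp (p :: w) = wordTp w ++ [ltp p] := by simp [wordTp, ltp]
    rw [this, altP_append]
    have h2 := ih h.2
    rw [length_wordTp]
    have h1 := h.1
    simp only [List.length_cons]
    rcases Nat.mod_two_eq_zero_or_one w.length with h | h
    · have : (w.length + 1) % 2 = 1 := by omega
      simp [h, this] at h2 ⊢
      simp [altP, h1, ltp, h2]
    · have : (w.length + 1) % 2 = 0 := by omega
      simp [h, this] at h2 ⊢
      simp [altP, h1, ltp, h2]

theorem altP_root {b : Bool} {u} {d : ℕ} (hd : 0 < d) (hu : u ≠ []) (h : altP b (wpow u d))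
    (he : (wpow u d).length % 2 = 0) : altP b u ∧ u.length % 2 = 0 := by
  obtain ⟨d, rfl⟩ : ∃ d', d = d' + 1 := ⟨d - 1, by omega⟩
  rw [wpow_succ, altP_append] at h
  refine ⟨h.1, ?_⟩
  cases d with
  | zero => simpa using he
  | succ d =>
    have h2 := h.2
    rw [wpow_succ, altP_append] at h2
    have := altP_unique hu h.1 h2.1
    by_contra hne
    have h3 : u.length % 2 = 1 := by omega
    simp [h3] at this

theorem altP_wpow {b : Bool} {u} (d : ℕ) (h : altP b u) (he : u.length % 2 = 0) : altP b (wpow u d) := by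
  induction d with
  | zero => simp [altP]
  | succ d ih => rw [wpow_succ, altP_append]; simpa [he] using ⟨h, ih⟩

theorem no_self {b : Bool} {u} (hu : u ≠ []) (h : altP b u) (he : u.length % 2 = 0) :
    ¬ u.IsRotated (wordTp u) := by
  rintro ⟨s', hs'⟩
  have hpos := List.length_pos_of_ne_nil hu
  obtain ⟨s, hs, hsl⟩ : ∃ s, u.rotate s = wordTp u ∧ s < u.length :=
    ⟨s' % u.length, by rw [List.rotate_mod, hs'], Nat.mod_lt _ hpos⟩
  have h1 := altP_rotate he h s
  have h2 := altP_wordTp h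
  rw [hs] at h1
  have hne : wordTp u ≠ [] := by
    intro h0
    have := congrArg List.length h0
    simp at this
    exact hu this
  have h3 := altP_unique hne h1 h2
  have h4 : s % 2 = 1 := by
    by_contra hs2
    simp [he, hs2] at h3
  have h5 : (u.rotate s)[(u.length - 1 - s) / 2]? = (wordTp u)[(u.length - 1 - s) / 2]? := by rw [hs]
  rw [List.getElem?_rotate (by omega), wordTp_eq, List.getElem?_reverse (by simp; omega)] at h5
  simp only [List.length_map, List.getElem?_map] at h5
  have h6 : ((u.length - 1 - s) / 2 + s) % u.length = u.length - 1 - (u.length - 1 - s) / 2 := by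
    rw [Nat.mod_eq_of_lt (by omega)]; omega
  rw [h6, List.getElem?_eq_getElem (by omega)] at h5
  simp [ltp] at h5
  have := congrArg Prod.snd h5
  simp at this

theorem block_iff (w : List PfLetter) : (∃ ps : List (Bool × Bool),
      w = (ps.map fun pr => [((false, pr.1) : PfLetter), (true, pr.2)]).flatten) ↔
      altP false w ∧ w.length % 2 = 0 := by
  constructor
  · rintro ⟨ps, rfl⟩
    induction ps with
    | nil => simp [altP]
    | cons p ps ih => simp only [List.map_cons, List.flatten_cons, List.cons_append, List.nil_append, altP, List.length_cons]; exact ⟨⟨trivial, rfl, ih.1⟩, by omega⟩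
  · rintro ⟨h1, h2⟩
    have : ∀ N, ∀ w : List PfLetter, w.length ≤ N → altP false w → w.length % 2 = 0 → (∃ ps : List (Bool × Bool),
      w = (ps.map fun pr => [((false, pr.1) : PfLetter), (true, pr.2)]).flatten) := by
      intro N
      induction N with
      | zero => intro w h _ _; exact ⟨[], List.eq_nil_of_length_eq_zero (by omega)⟩
      | succ N ih =>
        intro w h1 h2 h3
        match w with
        | [] => exact ⟨[], rfl⟩
        | [a] => simp at h3
        | a :: b :: w =>
          simp only [List.length_cons] at h1 h3
          obtain ⟨ha, hb, hw⟩ := h2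
          obtain ⟨ps, hps⟩ := ih w (by omega) hw (by omega)
          refine ⟨(a.2, b.2) :: ps, ?_⟩
          rw [hps]
          simp only [List.map_cons, List.flatten_cons, List.cons_append, List.nil_append]
          simp at hb
          rw [← ha, ← hb]
    exact this _ w le_rfl h1 h2
end PfW

namespace PfW

/-- all alternating words of given length -/
def altW : Bool → ℕ → Finset (List PfLetter)
  | _, 0 => {[]}
  | b, n + 1 => ((Finset.univ : Finset Bool) ×ˢ altW (!b) n).image (fun x => (b, x.1) :: x.2)

theorem mem_altW (b : Bool) (n : ℕ) (w) : w ∈ altW b n ↔ w.length = n ∧ altP b w := by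
  induction n generalizing b w with
  | zero =>
    simp only [altW, Finset.mem_singleton]
    constructor
    · rintro rfl; simp [altP]
    · rintro ⟨h, _⟩; exact List.eq_nil_of_length_eq_zero h
  | succ n ih =>
    simp only [altW, Finset.mem_image, Finset.mem_product, ih]
    constructor
    · rintro ⟨⟨p, w⟩, ⟨_, h1, h2⟩, rfl⟩
      simp [altP, h1, h2]
    · rintro ⟨h1, h2⟩
      cases w with
      | nil => simp at h1
      | cons p w =>
        refine ⟨(p.2, w), ⟨by simp, by simpa using h1, h2.2⟩, ?_⟩
        rw [← h2.1]

section mats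
variable {D : Type*} [CommRing D] {N : ℕ} (Y Z : Matrix (Fin N) (Fin N) D)

/-- signed letter matrix -/
def slm (p : PfLetter) : Matrix (Fin N) (Fin N) D :=
  if p.2 then - letterMat Y Z p else letterMat Y Z p

/-- signed word matrix -/
def smw (w : List PfLetter) : Matrix (Fin N) (Fin N) D := (w.map (slm Y Z)).prod

theorem smw_append (u v) : smw Y Z (u ++ v) = smw Y Z u * smw Y Z v := by simp [smw]
theorem smw_wpow (u) (d : ℕ) : smw Y Z (wpow u d) = smw Y Z u ^ d := by
  induction d with
  | zero => simp [smw]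
  | succ d ih => rw [wpow_succ, smw_append, ih, pow_succ']

theorem slm_ltp (p) : slm Y Z (ltp p) = - (slm Y Z p).transpose := by
  rcases p with ⟨a, b⟩
  cases a <;> cases b <;> simp [slm, ltp, letterMat]

theorem smw_wordTp (w) : smw Y Z (wordTp w) = (-1 : D) ^ w.length • (smw Y Z w).transpose := by
  induction w with
  | nil => simp [smw, wordTp]
  | cons p w ih =>
    have h1 : wordTp (p :: w) = wordTp w ++ [ltp p] := by simp [wordTp, ltp]
    have h2 : smw Y Z (p :: w) = slm Y Z p * smw Y Z w := by simp [smw]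
    have h3 : smw Y Z [ltp p] = - (slm Y Z p).transpose := by simp [smw, slm_ltp]
    rw [h1, smw_append, ih, h2, h3, Matrix.transpose_mul, List.length_cons, pow_succ]
    simp

theorem smw_wordTp_even {w : List PfLetter} (he : w.length % 2 = 0) :
    smw Y Z (wordTp w) = (smw Y Z w).transpose := by
  rw [smw_wordTp, Even.neg_one_pow (Nat.even_iff.2 he), one_smul]

theorem trace_rotate (w : List PfLetter) (i : ℕ) : (smw Y Z (w.rotate i)).trace = (smw Y Z w).trace := by
  obtain ⟨x, y, h1, h2⟩ := rotate_split w i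
  rw [h2, h1, smw_append, smw_append, Matrix.trace_mul_comm]

theorem charpoly_ct {u v : List PfLetter} (he : v.length % 2 = 0) (h : wordEqCT u v) :
    (smw Y Z u).charpoly = (smw Y Z v).charpoly := by
  have rot : ∀ u v : List PfLetter, u.IsRotated v → (smw Y Z u).charpoly = (smw Y Z v).charpoly := by
    rintro u v ⟨i, rfl⟩
    obtain ⟨x, y, h1, h2⟩ := rotate_split u i
    rw [h2, h1, smw_append, smw_append, Matrix.charpoly_mul_comm]
  rcases h with h | h
  · exact rot _ _ h
  · rw [rot _ _ h, smw_wordTp_even Y Z he, Matrix.charpoly_transpose]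

theorem sum_altW (b : Bool) (n : ℕ) : ∑ w ∈ altW b (n + 1), smw Y Z w =
    (if b then Z - Z.transpose else Y - Y.transpose) * ∑ w ∈ altW (!b) n, smw Y Z w := by
  rw [altW, Finset.sum_image]
  · rw [Finset.sum_product]
    have : ∀ p w, smw Y Z ((b, p) :: w) = slm Y Z (b, p) * smw Y Z w := by intro p w; simp [smw]
    simp only [this, ← Finset.mul_sum, ← Finset.sum_mul]
    congr 1
    cases b <;> simp [slm, letterMat] <;> abel
  · rintro ⟨p, w⟩ _ ⟨q, v⟩ _ h
    simpa using h

theorem sum_altW_pow (m : ℕ) : ∑ w ∈ altW false (2 * m), smw Y Z w =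
    ((Y - Y.transpose) * (Z - Z.transpose)) ^ m := by
  induction m with
  | zero => simp [altW, smw]
  | succ m ih =>
    rw [show 2 * (m + 1) = 2 * m + 1 + 1 by ring, sum_altW]
    simp only [Bool.not_false, sum_altW, Bool.not_true, ih]
    rw [pow_succ', mul_assoc]
    simp

theorem sum_altW_pow' (m : ℕ) : ∑ w ∈ altW true (2 * m), smw Y Z w =
    ((Z - Z.transpose) * (Y - Y.transpose)) ^ m := by
  induction m with
  | zero => simp [altW, smw]
  | succ m ih =>
    rw [show 2 * (m + 1) = 2 * m + 1 + 1 by ring, sum_altW]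
    simp only [Bool.not_false, sum_altW, Bool.not_true, ih]
    rw [pow_succ', mul_assoc]
    simp

theorem trace_pow_comm (P Q : Matrix (Fin N) (Fin N) D) (m : ℕ) :
    ((P * Q) ^ m).trace = ((Q * P) ^ m).trace := by
  cases m with
  | zero => simp
  | succ m =>
    have : ∀ m : ℕ, (P * Q) ^ m * P = P * (Q * P) ^ m := by
      intro m
      induction m with
      | zero => simp
      | succ m ih => rw [pow_succ', mul_assoc, ih, pow_succ' (Q * P)]; simp only [mul_assoc]
    rw [pow_succ, ← mul_assoc, this, Matrix.trace_mul_comm, pow_succ', ← mul_assoc]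

theorem trace_altW (m : ℕ) (hm : 0 < m) : ∑ w ∈ altW false (2 * m) ∪ altW true (2 * m), (smw Y Z w).trace =
    2 * (((Y - Y.transpose) * (Z - Z.transpose)) ^ m).trace := by
  rw [Finset.sum_union]
  · rw [← Matrix.trace_sum, ← Matrix.trace_sum, sum_altW_pow, sum_altW_pow', trace_pow_comm, two_mul]
  · rw [Finset.disjoint_left]
    intro w h1 h2
    rw [mem_altW] at h1 h2
    have hw : w ≠ [] := by rintro rfl; simp at h1; omega
    have := altP_unique hw h1.2 h2.2
    simp at this
end mats

/-- primitive block words -/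
def isPB (w : List PfLetter) : Prop := PrimitiveWord w ∧ altP false w ∧ w.length % 2 = 0

/-- equivalence on primitive block words -/
def pbSetoid : Setoid {w // isPB w} where
  r a b := wordEqCT a.1 b.1
  iseqv := ⟨fun a => ct_refl a.1, fun h => ct_symm h, fun h h' => ct_trans h h'⟩

open scoped Classical in
/-- canonical representative -/
noncomputable def repw (w : List PfLetter) : List PfLetter :=
  if h : isPB w then ((Quotient.mk pbSetoid ⟨w, h⟩).out).1 else w

theorem repw_ct {w} (h : isPB w) : wordEqCT w (repw w) := by
  rw [repw, dif_pos h]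
  exact ct_symm (Quotient.exact (s := pbSetoid) (Quotient.out_eq (s := pbSetoid) _))
theorem repw_pb {w} (h : isPB w) : isPB (repw w) := by
  rw [repw, dif_pos h]
  exact (Quotient.out (s := pbSetoid) _).2
theorem repw_eq {w w'} (h : isPB w) (h' : isPB w') (hc : wordEqCT w w') : repw w = repw w' := by
  rw [repw, dif_pos h, repw, dif_pos h']
  congr 2
  exact Quotient.sound (s := pbSetoid) hc
theorem repw_repw {w} (h : isPB w) : repw (repw w) = repw w :=
  (repw_eq h (repw_pb h) (repw_ct h)).symm

open scoped Classical in
/-- transversal of classes of bounded length -/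
noncomputable def Us (k : ℕ) : Finset (List PfLetter) :=
  ((Finset.range (2 * k + 1)).biUnion (fun l => altW false l)).filter (fun w => isPB w ∧ repw w = w)

theorem mem_Us (k : ℕ) (w) : w ∈ Us k ↔ isPB w ∧ repw w = w ∧ w.length ≤ 2 * k := by
  simp only [Us, Finset.mem_filter, Finset.mem_biUnion, Finset.mem_range, mem_altW]
  constructor
  · rintro ⟨⟨l, h1, h2, h3⟩, h4, h5⟩
    exact ⟨h4, h5, by omega⟩
  · rintro ⟨h1, h2, h3⟩
    exact ⟨⟨w.length, by omega, rfl, h1.2.1⟩, h1, h2⟩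

theorem isPB_pos {w} (h : isPB w) : 0 < w.length / 2 := by
  have := List.length_pos_of_ne_nil h.1.1
  have := h.2.2
  omega

/-- `u` or its transpose -/
def tpIf (b : Bool) (u : List PfLetter) : List PfLetter := if b then wordTp u else u

theorem tpIf_length (b u) : (tpIf b u).length = u.length := by cases b <;> simp [tpIf]
theorem tpIf_ct (b u) : wordEqCT u (tpIf b u) := by
  cases b
  · exact ct_refl u
  · right
    simp only [tpIf, if_true, wordTp_wordTp]
    exact List.IsRotated.refl u
theorem tpIf_prim {b u} (h : PrimitiveWord u) : PrimitiveWord (tpIf b u) := by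
  cases b
  · exact h
  · exact prim_wordTp h
theorem tpIf_alt {b u} (h : isPB u) : ∃ c, altP c (tpIf b u) := by
  cases b
  · exact ⟨_, h.2.1⟩
  · exact ⟨_, altP_wordTp h.2.1⟩

theorem trace_count {D : Type*} [CommRing D] {N : ℕ} (Y Z : Matrix (Fin N) (Fin N) D)
    (k m : ℕ) (hm : 0 < m) (hmk : m ≤ k) :
    ∑ w ∈ altW false (2 * m) ∪ altW true (2 * m), (smw Y Z w).trace =
    ∑ u ∈ (Us k).filter (fun u => u.length / 2 ∣ m), 
      (2 * u.length : ℕ) • (smw Y Z u ^ (m / (u.length / 2))).trace := by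
  have h0 : ∀ u ∈ (Us k).filter (fun u => u.length / 2 ∣ m), 
      (2 * u.length : ℕ) • (smw Y Z u ^ (m / (u.length / 2))).trace =
      ∑ _x ∈ (Finset.univ : Finset Bool) ×ˢ Finset.range u.length, (smw Y Z u ^ (m / (u.length / 2))).trace := by
    intro u _
    rw [Finset.sum_const]
    simp
  rw [Finset.sum_congr rfl h0, Finset.sum_sigma']
  symm
  refine Finset.sum_bij (fun x _ => wpow ((tpIf x.2.1 x.1).rotate x.2.2) (m / (x.1.length / 2))) ?_ ?_ ?_ ?_
  · rintro ⟨u, b, i⟩ h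
    simp only [Finset.mem_sigma, Finset.mem_filter, mem_Us, Finset.mem_product, Finset.mem_range] at h
    obtain ⟨⟨⟨h1, h2, h3⟩, h4⟩, -, h5⟩ := h
    simp only at h1 h2 h3 h4 h5 ⊢
    obtain ⟨c, hc⟩ := tpIf_alt (b := b) h1
    have hl : (tpIf b u).length % 2 = 0 := by rw [tpIf_length]; exact h1.2.2
    have h6 := altP_rotate hl hc i
    have h7 := altP_wpow (m / (u.length / 2)) h6 (by simpa using hl)
    have h8 : (wpow ((tpIf b u).rotate i) (m / (u.length / 2))).length = 2 * m := by
      simp only [length_wpow, List.length_rotate, tpIf_length]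
      obtain ⟨e, he⟩ := h4
      rw [he, Nat.mul_div_cancel_left _ (isPB_pos h1)]
      have : u.length = 2 * (u.length / 2) := by have := h1.2.2; omega
      conv_lhs => rw [this]
      ring
    rw [Finset.mem_union, mem_altW, mem_altW]
    cases hb : (c ^^ decide (i % 2 = 1)) <;> rw [hb] at h7
    · exact Or.inl ⟨h8, h7⟩
    · exact Or.inr ⟨h8, h7⟩
  · rintro ⟨u, b, i⟩ h ⟨u', b', i'⟩ h' heq
    simp only [Finset.mem_sigma, Finset.mem_filter, mem_Us, Finset.mem_product, Finset.mem_range] at h h'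
    obtain ⟨⟨⟨h1, h2, h3⟩, h4⟩, -, h5⟩ := h
    obtain ⟨⟨⟨h1', h2', h3'⟩, h4'⟩, -, h5'⟩ := h'
    simp only at h1 h2 h3 h4 h5 h1' h2' h3' h4' h5' heq
    have hr := root_unique (prim_rotate (tpIf_prim h1.1) i) (prim_rotate (tpIf_prim h1'.1) i')
      (Nat.div_pos (Nat.le_of_dvd hm h4) (isPB_pos h1)) (Nat.div_pos (Nat.le_of_dvd hm h4') (isPB_pos h1')) heq
    have hrot : (tpIf b u).IsRotated (tpIf b' u') := by
      have e1 : (tpIf b u).IsRotated ((tpIf b u).rotate i) := ⟨i, rfl⟩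
      have e2 : (tpIf b' u').IsRotated ((tpIf b' u').rotate i') := ⟨i', rfl⟩
      rw [hr] at e1
      exact e1.trans e2.symm
    have hct : wordEqCT u u' :=
      ct_trans (tpIf_ct b u) (ct_trans (Or.inl hrot) (ct_symm (tpIf_ct b' u')))
    have huu : u = u' := by rw [← h2, ← h2', repw_eq h1 h1' hct]
    subst huu
    have hbb : b = b' := by
      have hns := no_self h1.1.1 h1.2.1 h1.2.2
      cases b <;> cases b' <;> simp [tpIf] at hrot ⊢
      · exact hns hrot
      · exact hns hrot.symm
    subst hbb
    have hii : i = i' := prim_rotate_inj (tpIf_prim h1.1) (by rw [tpIf_length]; exact h5) (by rw [tpIf_length]; exact h5') hr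
    subst hii
    rfl
  · intro w hw
    rw [Finset.mem_union, mem_altW, mem_altW] at hw
    obtain ⟨c, hl, hc⟩ : ∃ c, w.length = 2 * m ∧ altP c w := by
      rcases hw with h | h
      · exact ⟨_, h⟩
      · exact ⟨_, h⟩
    have hne : w ≠ [] := by rintro rfl; simp at hl; omega
    obtain ⟨v, d, hd, hv, rfl⟩ := exists_root _ w le_rfl hne
    obtain ⟨hva, hve⟩ := altP_root hd hv.1 hc (by omega)
    rw [length_wpow] at hl
    obtain ⟨v', hv', hvv'⟩ : ∃ v', isPB v' ∧ v.IsRotated v' := by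
      cases c
      · exact ⟨v, ⟨hv, hva, hve⟩, List.IsRotated.refl v⟩
      · refine ⟨v.rotate 1, ⟨prim_rotate hv 1, ?_, by simpa using hve⟩, ⟨1, rfl⟩⟩
        simpa using altP_rotate hve hva 1
    have hct : wordEqCT v (repw v') := ct_trans (Or.inl hvv') (repw_ct hv')
    have hlen : v.length = (repw v').length := ct_length hct
    obtain ⟨b, hb⟩ : ∃ b, (tpIf b (repw v')).IsRotated v := by
      rcases hct with h | h
      · exact ⟨false, h.symm⟩
      · exact ⟨true, h.symm⟩
    obtain ⟨i, hi⟩ := hb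
    have hpos := List.length_pos_of_ne_nil hv.1
    have hm2 : m = d * (v.length / 2) := by
      have : v.length = 2 * (v.length / 2) := by omega
      rw [this] at hl
      nlinarith
    have hpos2 : 0 < v.length / 2 := by omega
    refine ⟨⟨repw v', b, i % v.length⟩, ?_, ?_⟩
    · simp only [Finset.mem_sigma, Finset.mem_filter, mem_Us, Finset.mem_product, Finset.mem_range, ← hlen]
      refine ⟨⟨⟨repw_pb hv', repw_repw hv', ?_⟩, ?_⟩, by simp, Nat.mod_lt _ hpos⟩
      · have : v.length / 2 ≤ m := by rw [hm2]; exact Nat.le_mul_of_pos_left _ hd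
        omega
      · rw [hm2]; exact dvd_mul_left _ _
    · simp only [← hlen]
      have : v.length = (tpIf b (repw v')).length := by rw [tpIf_length, hlen]
      rw [this, List.rotate_mod, hi, ← this]
      congr 1
      rw [hm2, Nat.mul_div_cancel _ hpos2]
  · rintro ⟨u, b, i⟩ h
    simp only [Finset.mem_sigma, Finset.mem_filter, mem_Us, Finset.mem_product, Finset.mem_range] at h
    obtain ⟨⟨⟨h1, h2, h3⟩, h4⟩, -, h5⟩ := h
    simp only at h1 h2 h3 h4 h5 ⊢
    rw [smw_wpow]
    obtain ⟨x, y, hx, hy⟩ := rotate_split (tpIf b u) i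
    rw [hy, smw_append, trace_pow_comm, ← smw_append, ← hx]
    cases b
    · rfl
    · simp only [tpIf, if_true]
      rw [smw_wordTp_even Y Z h1.2.2, ← Matrix.transpose_pow, Matrix.trace_transpose]
end PfW

namespace PfW
open PowerSeries

theorem nd_prod {D : Type*} [CommRing D] {ι : Type*} [DecidableEq ι] (s : Finset ι) (f p : ι → D⟦X⟧)
    (h : ∀ i ∈ s, X * d⁄dX D (f i) = - f i * p i) :
    X * d⁄dX D (∏ i ∈ s, f i) = - (∏ i ∈ s, f i) * ∑ i ∈ s, p i := by
  induction s using Finset.induction_on with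
  | empty => simp
  | insert a s ha ih =>
    have h1 := ih fun i hi => h i (Finset.mem_insert_of_mem hi)
    have h2 := h a (Finset.mem_insert_self _ _)
    rw [Finset.prod_insert ha, Derivation.leibniz, Finset.sum_insert ha]
    simp only [smul_eq_mul]
    linear_combination (f a) * h1 + (∏ i ∈ s, f i) * h2

/-- the generating series over representatives -/
noncomputable def Rs {D : Type*} [CommRing D] {N : ℕ} (Y Z : Matrix (Fin N) (Fin N) D) (k : ℕ) : D⟦X⟧ :=
  ∏ u ∈ Us k, psdet (u.length / 2) (smw Y Z u)

theorem Rs_const {D : Type*} [CommRing D] {N : ℕ} (Y Z : Matrix (Fin N) (Fin N) D) (k : ℕ) :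
    constantCoeff (Rs Y Z k) = 1 := by
  rw [Rs, map_prod]
  exact Finset.prod_eq_one fun u hu => psdet_const _ (isPB_pos ((mem_Us k u).1 hu).1) _

theorem Rs_sq {D : Type*} [CommRing D] [IsDomain D] [CharZero D] {N : ℕ}
    (Y Z : Matrix (Fin N) (Fin N) D) (k : ℕ) :
    ∀ j ≤ k, coeff j (Rs Y Z k ^ 2) = coeff j (psdet 1 ((Y - Y.transpose) * (Z - Z.transpose))) := by
  classical
  set L : D⟦X⟧ := ∑ u ∈ Us k, ((u.length / 2 : ℕ) : D⟦X⟧) * psum (u.length / 2) (smw Y Z u) with hL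
  have hR : X * d⁄dX D (Rs Y Z k) = - Rs Y Z k * L :=
    nd_prod _ _ _ fun u hu => psdet_newton _ (isPB_pos ((mem_Us k u).1 hu).1) _
  have h1 := psdet_newton 1 one_pos ((Y - Y.transpose) * (Z - Z.transpose))
  have hcast : ∀ (n j : ℕ) (f : D⟦X⟧), coeff j ((n : D⟦X⟧) * f) = n * coeff j f := by
    intro n j f
    rw [← nsmul_eq_mul, map_nsmul, nsmul_eq_mul]
  refine log_unique k _ _ (2 * L) _ ?_ h1 ?_ (psdet_const 1 one_pos _) ?_ ?_ ?_
  · rw [Derivation.leibniz_pow]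
    simp only [smul_eq_mul, nsmul_eq_mul]
    push_cast
    linear_combination (2 * Rs Y Z k) * hR
  · simp [Rs_const]
  · rw [hL, map_mul, map_sum, Finset.sum_eq_zero, mul_zero]
    intro u _
    simp [psum]
  · simp [psum]
  · intro m hm
    by_cases h0 : m = 0
    · subst h0
      simp [hL, psum]
    · have h2 := trace_altW Y Z m (Nat.pos_of_ne_zero h0)
      have h3 := trace_count Y Z k m (Nat.pos_of_ne_zero h0) hm
      rw [h2] at h3
      have h4 : coeff m (2 * L) = 2 * ∑ u ∈ (Us k).filter (fun u => u.length / 2 ∣ m),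
          ((u.length / 2 : ℕ) : D) * (smw Y Z u ^ (m / (u.length / 2))).trace := by
        have := hcast 2 m L
        push_cast at this
        rw [this, hL, map_sum, Finset.sum_filter]
        congr 1
        refine Finset.sum_congr rfl fun u _ => ?_
        rw [hcast, psum, coeff_mk]
        simp [h0]
      have h5 : coeff m (((1 : ℕ) : D⟦X⟧) * psum 1 ((Y - Y.transpose) * (Z - Z.transpose))) =
          (((Y - Y.transpose) * (Z - Z.transpose)) ^ m).trace := by
        rw [hcast, psum, coeff_mk]; simp [h0]
      rw [h4, h5]
      apply mul_left_cancel₀ (two_ne_zero : (2 : D) ≠ 0)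
      rw [h3, Finset.mul_sum, Finset.mul_sum]
      refine Finset.sum_congr rfl fun u hu => ?_
      have h6 := ((mem_Us k u).1 (Finset.mem_filter.1 hu).1).1.2.2
      have h7 : 2 * u.length = 2 * (2 * (u.length / 2)) := by omega
      rw [nsmul_eq_mul, h7]
      push_cast
      ring
end PfW

namespace PfW
open PowerSeries

theorem sq_trunc {D : Type*} [CommRing D] [IsDomain D] [CharZero D] (k : ℕ) (f g : D⟦X⟧)
    (h : ∀ j ≤ k, coeff j (f ^ 2) = coeff j (g ^ 2)) (hg : constantCoeff g ≠ 0) :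
    (∀ j ≤ k, coeff j f = coeff j g) ∨
    (∀ j ≤ k, coeff j f = - coeff j g) := by
  have h1 : (X : D⟦X⟧) ^ (k + 1) ∣ (f - g) * (f + g) := by
    rw [X_pow_dvd_iff]
    intro m hm
    have : (f - g) * (f + g) = f ^ 2 - g ^ 2 := by ring
    rw [this, map_sub, h m (by omega), sub_self]
  by_cases hX : (X : D⟦X⟧) ∣ (f + g)
  · right
    have h2 : ¬ (X : D⟦X⟧) ∣ (f - g) := by
      rw [X_dvd_iff] at hX ⊢
      intro h3
      rw [map_sub] at h3
      rw [map_add] at hX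
      have : 2 * constantCoeff g = 0 := by linear_combination hX - h3
      simp [hg] at this
    have h3 := (X_prime (R := D)).pow_dvd_of_dvd_mul_left _ h2 h1
    rw [X_pow_dvd_iff] at h3
    intro j hj
    have := h3 j (by omega)
    rw [map_add] at this
    linear_combination this
  · left
    have h3 := (X_prime (R := D)).pow_dvd_of_dvd_mul_right _ hX h1
    rw [X_pow_dvd_iff] at h3
    intro j hj
    have := h3 j (by omega)
    rw [map_sub] at this
    linear_combination this

theorem coeff_prod_lin {D : Type*} [CommRing D] {ι : Type*} [DecidableEq ι] (s : Finset ι) (a b : ι → D) :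
    coeff s.card (∏ i ∈ s, (C (a i) + X * C (b i))) = ∏ i ∈ s, b i ∧
    ∀ j, s.card < j → coeff j (∏ i ∈ s, (C (a i) + X * C (b i))) = 0 := by
  induction s using Finset.induction_on with
  | empty =>
    refine ⟨by simp, ?_⟩
    intro j hj
    simp only [Finset.card_empty] at hj
    rw [Finset.prod_empty, coeff_one, if_neg (by omega)]
  | insert x s hx ih =>
    have key : ∀ (j : ℕ) (f : D⟦X⟧), coeff (j + 1) ((C (a x) + X * C (b x)) * f) =
        a x * coeff (j + 1) f + b x * coeff j f := by
      intro j f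
      rw [add_mul, map_add, coeff_C_mul, mul_assoc, coeff_succ_X_mul, coeff_C_mul]
    rw [Finset.card_insert_of_notMem hx, Finset.prod_insert hx, Finset.prod_insert hx, key, ih.1, ih.2 _ (Nat.lt_succ_self _)]
    refine ⟨by ring, ?_⟩
    intro j hj
    obtain ⟨j, rfl⟩ : ∃ i, j = i + 1 := ⟨j - 1, by omega⟩
    rw [key, ih.2 _ (by omega), ih.2 _ (by omega)]
    ring

theorem coeff_pf {D : Type*} [CommRing D] {k : ℕ} (P Q : Matrix (Fin (2 * k)) (Fin (2 * k)) D) :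
    coeff k (pfaffian (P.map (C (R := D)) + (X : D⟦X⟧) • Q.map (C (R := D)))) = pfaffian Q := by
  classical
  unfold pfaffian
  rw [map_sum]
  refine Finset.sum_congr rfl fun π _ => ?_
  rw [map_zsmul]
  congr 1
  rw [pairProd_eq, pairProd_eq]
  have := (coeff_prod_lin (Finset.univ : Finset (Fin k))
    (fun i => P (π (pe k (i, false))) (π (pe k (i, true))))
    (fun i => Q (π (pe k (i, false))) (π (pe k (i, true))))).1
  simpa using this

theorem pf_smul {D : Type*} [CommRing D] {k : ℕ} (c : D) (Q : Matrix (Fin (2 * k)) (Fin (2 * k)) D) :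
    pfaffian (c • Q) = c ^ k * pfaffian Q := by
  classical
  unfold pfaffian
  rw [Finset.mul_sum]
  refine Finset.sum_congr rfl fun π _ => ?_
  rw [pairProd_eq, pairProd_eq, mul_smul_comm]
  congr 1
  simp [Finset.prod_mul_distrib]

theorem psdet_map {D E : Type*} [CommRing D] [CommRing E] (f : D →+* E) {n : Type*} [DecidableEq n] [Fintype n]
    (l : ℕ) (M : Matrix n n D) : PowerSeries.map f (psdet l M) = psdet l (M.map f) := by
  rw [psdet, psdet, RingHom.map_det]
  congr 1
  ext i j : 2
  by_cases h : i = j <;> simp [h]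

theorem smw_map {D E : Type*} [CommRing D] [CommRing E] (f : D →+* E) {N : ℕ} (Y Z : Matrix (Fin N) (Fin N) D)
    (w) : (smw Y Z w).map f = smw (Y.map f) (Z.map f) w := by
  have h : ∀ p, (slm Y Z p).map f = slm (Y.map f) (Z.map f) p := by
    rintro ⟨a, b⟩
    ext i j
    cases a <;> cases b <;> simp [slm, letterMat]
  induction w with
  | nil => simp [smw]
  | cons p w ih =>
    have e : ∀ (Y Z : Matrix (Fin N) (Fin N) D), smw Y Z (p :: w) = slm Y Z p * smw Y Z w := by intros; simp [smw]
    have e' : ∀ (Y Z : Matrix (Fin N) (Fin N) E), smw Y Z (p :: w) = slm Y Z p * smw Y Z w := by intros; simp [smw]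
    rw [e, e', Matrix.map_mul, h, ih]

theorem Rs_map {D E : Type*} [CommRing D] [CommRing E] (f : D →+* E) {N : ℕ} (Y Z : Matrix (Fin N) (Fin N) D)
    (k : ℕ) : PowerSeries.map f (Rs Y Z k) = Rs (Y.map f) (Z.map f) k := by
  rw [Rs, Rs, map_prod]
  simp only [psdet_map, smw_map]

theorem genPf_map {A B : Type*} [CommRing A] [CommRing B] (f : A →+* B) {k : ℕ}
    (Y : Matrix (Fin (2 * k)) (Fin (2 * k)) A) : genPf (Y.map f) = f (genPf Y) := by
  rw [genPf, genPf, ← pf_map]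
  congr 1
  ext i j
  simp

theorem main_pm {D : Type*} [CommRing D] [IsDomain D] [CharZero D] {k : ℕ}
    (Y Z : Matrix (Fin (2 * k)) (Fin (2 * k)) D) (hd : (Z - Z.transpose).det ≠ 0) :
    genPf Y * genPf Z = coeff k (Rs Y Z k) ∨ genPf Y * genPf Z = - coeff k (Rs Y Z k) := by
  classical
  have hR := Rs_sq Y Z k
  unfold genPf
  set A := Y - Y.transpose with hA
  set B := Z - Z.transpose with hB
  have hAt : A.transpose = - A := by simp [hA]
  have hBt : B.transpose = - B := by simp [hB]
  by_cases hk : k = 0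
  · subst hk
    left
    have e : ∀ M : Matrix (Fin (2 * 0)) (Fin (2 * 0)) D, pfaffian M = 1 := by
      intro M
      have : M = Jm D 0 := by ext i; exact i.elim0
      rw [this, pf_Jm]
    rw [e, e, coeff_zero_eq_constantCoeff, Rs_const, one_mul]
  have hadj : B.adjugate.transpose = - B.adjugate := by
    rw [Matrix.adjugate_transpose, hBt, ← neg_one_smul D, Matrix.adjugate_smul, Fintype.card_fin]
    rw [Odd.neg_one_pow ⟨k - 1, by omega⟩, neg_one_smul]
  set δ := B.det with hδ
  set M : Matrix (Fin (2 * k)) (Fin (2 * k)) D⟦X⟧ :=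
    B.adjugate.map (C (R := D)) + (X : D⟦X⟧) • ((-δ) • A).map (C (R := D)) with hM
  have hMt : M.transpose = - M := by
    apply Matrix.ext; intro i j
    have h1 := congrFun (congrFun hadj i) j
    have h2 := congrFun (congrFun hAt i) j
    simp only [Matrix.transpose_apply, Matrix.neg_apply] at h1 h2
    simp only [hM, Matrix.transpose_apply, Matrix.neg_apply, Matrix.add_apply, Matrix.smul_apply, Matrix.map_apply,
      h1, h2, smul_eq_mul, map_mul, map_neg]
    ring
  have hMB : M * B.map (C (R := D)) = C δ • (1 - (X ^ 1 : D⟦X⟧) • (A * B).map (C (R := D))) := by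
    have h1 : B.adjugate.map (C (R := D)) * B.map (C (R := D)) = C δ • (1 : Matrix (Fin (2*k)) (Fin (2*k)) D⟦X⟧) := by
      rw [← Matrix.map_mul, Matrix.adjugate_mul]
      ext i j : 2
      by_cases h : i = j <;> simp [h, hδ]
    have h2 : ((-δ) • A).map (C (R := D)) = - (C δ) • A.map (C (R := D)) := by
      ext i j : 2
      simp
    rw [hM, add_mul, h1, h2, Matrix.map_mul]
    simp only [pow_one, Matrix.smul_mul, neg_smul, Matrix.neg_mul, smul_neg, sub_eq_add_neg]
    rw [smul_comm, smul_add, smul_neg]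
  have hdet : M.det * C δ = C δ ^ (2 * k) * psdet 1 (A * B) := by
    have := congrArg Matrix.det hMB
    rw [Matrix.det_mul, Matrix.det_smul, Fintype.card_fin] at this
    rw [psdet, ← this]
    congr 1
    rw [hδ, RingHom.map_det]; rfl
  have hMd : M.det ≠ 0 := by
    intro h0
    rw [h0, zero_mul] at hdet
    have := congrArg constantCoeff hdet
    simp [psdet_const] at this
    exact hd (pow_eq_zero_iff (by omega) |>.1 this.symm)
  have : CharZero D⟦X⟧ := charZero_of_injective_ringHom (f := C (R := D)) C_injective
  have hM2 := pf_sq M hMt hMd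
  have hB2 := pf_sq B hBt hd
  set Q := C (pfaffian B) * pfaffian M with hQ
  have hQ2 : Q ^ 2 = C δ ^ (2 * k) * psdet 1 (A * B) := by
    rw [hQ, mul_pow, hM2, ← map_pow, hB2, ← hdet, mul_comm]
  have hQk : coeff k Q = (-δ) ^ k * (pfaffian A * pfaffian B) := by
    rw [hQ, coeff_C_mul, hM, coeff_pf, pf_smul]; ring
  have h3 : ∀ j ≤ k, coeff j (Q ^ 2) = coeff j ((C (δ ^ k) * Rs Y Z k) ^ 2) := by
    intro j hj
    rw [hQ2, mul_pow, ← map_pow, ← map_pow, coeff_C_mul, coeff_C_mul, hR j hj, ← pow_mul, mul_comm k 2]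
  have h4 := sq_trunc k Q (C (δ ^ k) * Rs Y Z k) h3 (by
    rw [map_mul, Rs_const, constantCoeff_C, mul_one]
    exact pow_ne_zero _ hd)
  have hδk : δ ^ k ≠ 0 := pow_ne_zero _ hd
  rw [neg_pow, mul_assoc] at hQk
  have hs : (-1 : D) ^ k = 1 ∨ (-1 : D) ^ k = -1 := neg_one_pow_eq_or D k
  rcases h4 with h4 | h4 <;> have h5 := h4 k le_rfl <;> rw [hQk, coeff_C_mul] at h5 <;>
    rcases hs with hs | hs <;> rw [hs] at h5
  · left; apply mul_left_cancel₀ hδk; linear_combination h5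
  · right; apply mul_left_cancel₀ hδk; linear_combination -h5
  · right; apply mul_left_cancel₀ hδk; linear_combination h5
  · left; apply mul_left_cancel₀ hδk; linear_combination -h5

/-- half of the standard symplectic matrix -/
def Jh (k : ℕ) : Matrix (Fin (2 * k)) (Fin (2 * k)) ℤ := fun x y => if x < y then Jm ℤ k x y else 0

theorem Jh_sub (k : ℕ) : Jh k - (Jh k).transpose = Jm ℤ k := by
  ext x y
  have h1 : Jm ℤ k y x = - Jm ℤ k x y := congrFun (congrFun (Jm_transpose ℤ k) x) y
  have h2 : x = y → Jm ℤ k x y = 0 := by rintro rfl; omega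
  simp only [Matrix.sub_apply, Matrix.transpose_apply, Jh]
  rcases lt_trichotomy x y with h | h | h
  · simp [h, h.le]
  · simp [h]
    subst h; rw [h2 rfl]
  · simp [h, h.le, h1]

theorem Rs_Jh (k : ℕ) : coeff k (Rs (Jh k) (Jh k) k) = 1 := by
  have h1 := Rs_sq (Jh k) (Jh k) k
  rw [Jh_sub, Jm_sq] at h1
  have h2 : psdet 1 (-1 : Matrix (Fin (2 * k)) (Fin (2 * k)) ℤ) = ((1 + X) ^ k) ^ 2 := by
    have : (1 : Matrix (Fin (2 * k)) (Fin (2 * k)) ℤ⟦X⟧) - (X ^ 1 : ℤ⟦X⟧) • (-1 : Matrix (Fin (2 * k)) (Fin (2 * k)) ℤ).map (C (R := ℤ))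
        = (1 + X : ℤ⟦X⟧) • 1 := by
      ext i j : 2
      by_cases h : i = j <;> simp [h]
    rw [psdet, this, Matrix.det_smul, Fintype.card_fin, Matrix.det_one, mul_one, ← pow_mul, mul_comm]
  rw [h2] at h1
  rcases sq_trunc k _ _ h1 (by simp) with h | h
  · rw [h k le_rfl]
    have := (coeff_prod_lin (Finset.univ : Finset (Fin k)) (fun _ => (1 : ℤ)) (fun _ => (1 : ℤ))).1
    simpa using this
  · have := h 0 (Nat.zero_le _)
    rw [coeff_zero_eq_constantCoeff, Rs_const] at this
    simp at this

/-- generic matrices -/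
noncomputable def gm (k : ℕ) (b : Bool) : Matrix (Fin (2 * k)) (Fin (2 * k))
    (MvPolynomial (Bool × Fin (2 * k) × Fin (2 * k)) ℤ) := fun i j => MvPolynomial.X (b, i, j)

/-- specialization -/
noncomputable def spec {A : Type*} [CommRing A] {k : ℕ} (Y Z : Matrix (Fin (2 * k)) (Fin (2 * k)) A) :
    MvPolynomial (Bool × Fin (2 * k) × Fin (2 * k)) ℤ →+* A :=
  MvPolynomial.eval₂Hom (Int.castRingHom A) fun x => if x.1 then Z x.2.1 x.2.2 else Y x.2.1 x.2.2

theorem spec_Y {A : Type*} [CommRing A] {k : ℕ} (Y Z : Matrix (Fin (2 * k)) (Fin (2 * k)) A) :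
    (gm k false).map (spec Y Z) = Y := by
  ext i j; simp [gm, spec]

theorem spec_Z {A : Type*} [CommRing A] {k : ℕ} (Y Z : Matrix (Fin (2 * k)) (Fin (2 * k)) A) :
    (gm k true).map (spec Y Z) = Z := by
  ext i j; simp [gm, spec]

theorem main_eq {A : Type*} [CommRing A] {k : ℕ} (Y Z : Matrix (Fin (2 * k)) (Fin (2 * k)) A) :
    genPf Y * genPf Z = coeff k (Rs Y Z k) := by
  have hd : (gm k true - (gm k true).transpose).det ≠ 0 := by
    intro h
    have h2 := congrArg (spec (Jh k) (Jh k)) h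
    rw [RingHom.map_det, map_zero] at h2
    have : (spec (Jh k) (Jh k)).mapMatrix (gm k true - (gm k true).transpose) = Jm ℤ k := by
      rw [← Jh_sub, map_sub]
      conv_rhs => rw [← spec_Z (Jh k) (Jh k)]
      rfl
    rw [this, det_Jm] at h2
    exact one_ne_zero h2
  have hgen : genPf (gm k false) * genPf (gm k true) = coeff k (Rs (gm k false) (gm k true) k) := by
    rcases main_pm _ _ hd with h | h
    · exact h
    · exfalso
      have h2 := congrArg (spec (Jh k) (Jh k)) h
      rw [map_mul, ← genPf_map, ← genPf_map, map_neg, ← PowerSeries.coeff_map, Rs_map, spec_Y, spec_Z, Rs_Jh, genPf,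
        Jh_sub, pf_Jm] at h2
      norm_num at h2
  have h2 := congrArg (spec Y Z) hgen
  rw [map_mul, ← genPf_map, ← genPf_map, ← PowerSeries.coeff_map, Rs_map, spec_Y, spec_Z] at h2
  exact h2
end PfW

namespace PfW
open PowerSeries

theorem block_count {w : List PfLetter} (h : ∃ ps : List (Bool × Bool),
      w = (ps.map fun pr => [((false, pr.1) : PfLetter), (true, pr.2)]).flatten) :
    w.countP (fun p => p.1 = false) = w.length / 2 ∧ w.countP (fun p => p.1 = true) = w.length / 2 ∧
    w.length = 2 * (w.length / 2) := by
  obtain ⟨ps, rfl⟩ := h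
  have : ∀ ps : List (Bool × Bool),
     ((ps.map fun pr => [((false, pr.1) : PfLetter), (true, pr.2)]).flatten).countP (fun p => p.1 = false) = ps.length ∧
     ((ps.map fun pr => [((false, pr.1) : PfLetter), (true, pr.2)]).flatten).countP (fun p => p.1 = true) = ps.length ∧
     ((ps.map fun pr => [((false, pr.1) : PfLetter), (true, pr.2)]).flatten).length = 2 * ps.length := by
    intro ps
    induction ps with
    | nil => simp
    | cons a ps ih =>
      obtain ⟨h1, h2, h3⟩ := ih
      rw [List.map_cons, List.flatten_cons, List.countP_append, List.countP_append, List.length_append, h1, h2, h3]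
      simp
      omega
  obtain ⟨h1, h2, h3⟩ := this ps
  rw [h1, h2, h3]
  omega

theorem idx_iff (k : ℕ) (M : Multiset (List PfLetter)) : PfIndex k M ↔
    (∀ w ∈ M, isPB w) ∧ (∀ w ∈ M, ∀ w' ∈ M, wordEqCT w w' → w = w') ∧
    (M.map fun w => w.length / 2).sum = k := by
  constructor
  · rintro ⟨h1, h2, h3, h4, h5⟩
    refine ⟨fun w hw => ⟨h1 w hw, ((block_iff w).1 (h2 w hw))⟩, h3, ?_⟩
    rw [← h4]
    congr 1
    exact Multiset.map_congr rfl fun w hw => (block_count (h2 w hw)).1.symm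
  · rintro ⟨h1, h2, h3⟩
    have hb := fun w hw => (block_iff w).2 (h1 w hw).2
    refine ⟨fun w hw => (h1 w hw).1, hb, h2, ?_, ?_⟩
    · rw [← h3]
      congr 1
      exact Multiset.map_congr rfl fun w hw => (block_count (hb w hw)).1
    · rw [← h3]
      congr 1
      exact Multiset.map_congr rfl fun w hw => (block_count (hb w hw)).2.1

theorem idx_len {k : ℕ} {M : Multiset (List PfLetter)} (h : PfIndex k M) {w} (hw : w ∈ M) :
    w.length ≤ 2 * k := by
  obtain ⟨h1, h2, h3⟩ := (idx_iff k M).1 h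
  have := Multiset.single_le_sum (fun _ _ => Nat.zero_le _) _ (Multiset.mem_map_of_mem (fun w : List PfLetter => w.length / 2) hw)
  have h4 := (h1 w hw).2.2
  omega

theorem repw_len {w} (h : isPB w) : (repw w).length = w.length := (ct_length (repw_ct h)).symm

theorem repw_Us {k : ℕ} {w} (h : isPB w) (hl : w.length ≤ 2 * k) : repw w ∈ Us k :=
  (mem_Us k _).2 ⟨repw_pb h, repw_repw h, by rw [repw_len h]; exact hl⟩

theorem repw_inj {w w'} (h : isPB w) (h' : isPB w') (e : repw w = repw w') : wordEqCT w w' :=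
  ct_trans (repw_ct h) (e ▸ ct_symm (repw_ct h'))

/-- exponents attached to a multiset of words -/
noncomputable def phi (M : Multiset (List PfLetter)) : List PfLetter →₀ ℕ :=
  Finsupp.onFinset (M.map repw).toFinset (fun u => u.length / 2 * (M.map repw).count u) (by
    intro u hu
    rw [Multiset.mem_toFinset, ← Multiset.count_ne_zero]
    exact right_ne_zero_of_mul hu)

theorem phi_apply (M u) : phi M u = u.length / 2 * (M.map repw).count u := rfl

theorem map_rep_Us {k : ℕ} {M : Multiset (List PfLetter)} (h : PfIndex k M) {u} (hu : u ∈ M.map repw) :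
    u ∈ Us k := by
  obtain ⟨w, hw, rfl⟩ := Multiset.mem_map.1 hu
  exact repw_Us (((idx_iff k M).1 h).1 w hw) (idx_len h hw)

theorem phi_mem {k : ℕ} {M : Multiset (List PfLetter)} (h : PfIndex k M) :
    phi M ∈ Finset.finsuppAntidiag (Us k) k := by
  rw [Finset.mem_finsuppAntidiag]
  have hs : (M.map repw).toFinset ⊆ Us k := fun u hu => map_rep_Us h (Multiset.mem_toFinset.1 hu)
  obtain ⟨h1, h2, h3⟩ := (idx_iff k M).1 h
  constructor
  · have h4 : ((M.map repw).map fun w => w.length / 2).sum = k := by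
      rw [Multiset.map_map, ← h3]
      congr 1
      exact Multiset.map_congr rfl fun w hw => by simp [repw_len (h1 w hw)]
    rw [Finset.sum_multiset_map_count] at h4
    refine Eq.trans ?_ h4
    symm
    refine (Finset.sum_subset hs ?_).trans ?_
    · intro u _ hu
      rw [Multiset.mem_toFinset] at hu
      simp [Multiset.count_eq_zero_of_notMem hu]
    · exact Finset.sum_congr rfl fun u _ => by rw [phi_apply, smul_eq_mul, mul_comm]
  · exact (Finsupp.support_onFinset_subset).trans hs

theorem rel_of_map {M M' : Multiset (List PfLetter)} (h : ∀ w ∈ M, isPB w) (h' : ∀ w ∈ M', isPB w)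
    (e : M.map repw = M'.map repw) : Multiset.Rel wordEqCT M M' := by
  have : Multiset.Rel (fun a b => repw a = repw b) M M' := by
    rw [← Multiset.rel_map, Multiset.rel_eq]; exact e
  exact this.mono fun a ha b hb hab => repw_inj (h a ha) (h' b hb) hab

theorem map_of_rel {M M' : Multiset (List PfLetter)} (h : ∀ w ∈ M, isPB w) (h' : ∀ w ∈ M', isPB w)
    (r : Multiset.Rel wordEqCT M M') : M.map repw = M'.map repw := by
  rw [← Multiset.rel_eq, Multiset.rel_map]
  exact r.mono fun a ha b hb hab => repw_eq (h a ha) (h' b hb) hab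

theorem phi_inj {k : ℕ} {M M' : Multiset (List PfLetter)} (h : PfIndex k M) (h' : PfIndex k M')
    (e : phi M = phi M') : M.map repw = M'.map repw := by
  ext u
  by_cases hu : u ∈ Us k
  · have := DFunLike.congr_fun e u
    rw [phi_apply, phi_apply] at this
    exact Nat.eq_of_mul_eq_mul_left (isPB_pos ((mem_Us k u).1 hu).1) this
  · rw [Multiset.count_eq_zero_of_notMem fun h1 => hu (map_rep_Us h h1),
      Multiset.count_eq_zero_of_notMem fun h1 => hu (map_rep_Us h' h1)]

theorem smw_sign {D : Type*} [CommRing D] {N : ℕ} (Y Z : Matrix (Fin N) (Fin N) D) (w : List PfLetter) :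
    smw Y Z w = (-1 : D) ^ (w.length + w.count (false, false) + w.count (true, false)) •
      (w.map (letterMat Y Z)).prod := by
  induction w with
  | nil => simp [smw]
  | cons p w ih =>
    have e : smw Y Z (p :: w) = slm Y Z p * smw Y Z w := by simp [smw]
    rw [e, ih, List.map_cons, List.prod_cons, Matrix.mul_smul]
    obtain ⟨a, b⟩ := p
    cases a <;> cases b <;> simp [slm, pow_add]

theorem factor_eq {D : Type*} [CommRing D] {k : ℕ} (Y Z : Matrix (Fin (2 * k)) (Fin (2 * k)) D)
    {w : List PfLetter} (h : isPB w) (c : ℕ) (hc : c ≤ 2 * k) :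
    (-1 : D) ^ (c * (w.count (false, false) + w.count (true, false) + 1)) *
      sigmaCoeff (2 * k) ((w.map (letterMat Y Z)).prod) c =
    coeff ((repw w).length / 2 * c) (psdet ((repw w).length / 2) (smw Y Z (repw w))) := by
  have hl := isPB_pos h
  have key : ∀ M : Matrix (Fin (2 * k)) (Fin (2 * k)) D, ∀ s : D,
      coeff (w.length / 2 * c) (psdet (w.length / 2) (s • M)) = s ^ c * M.charpoly.coeff (2 * k - c) := by
    intro M s
    rw [psdet_coeff _ hl, if_pos (dvd_mul_right _ _), Nat.mul_div_cancel_left _ hl, charpolyRev_coeff _ _ (by simpa using hc),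
      Fintype.card_fin]
  have k2 : coeff (w.length / 2 * c) (psdet (w.length / 2) (smw Y Z (repw w))) =
      coeff (w.length / 2 * c) (psdet (w.length / 2) (smw Y Z w)) := by
    have a := key (smw Y Z (repw w)) 1
    have b := key (smw Y Z w) 1
    rw [one_smul] at a b
    rw [a, b, charpoly_ct Y Z (by rw [repw_len h]; exact h.2.2) (repw_ct h)]
  rw [repw_len h, k2, smw_sign, key, sigmaCoeff, ← mul_assoc, ← pow_add, ← pow_mul]
  congr 1
  have hev : Even w.length := Nat.even_iff.2 h.2.2
  obtain ⟨r, hr⟩ := hev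
  rw [hr]
  have : ∀ a b : ℕ, a % 2 = b % 2 → (-1 : D) ^ a = (-1) ^ b := by
    intro a b hab
    rw [neg_one_pow_eq_pow_mod_two a, neg_one_pow_eq_pow_mod_two b, hab]
  apply this
  have e1 : c * (List.count (false, false) w + List.count (true, false) w + 1) + c =
    c * (List.count (false, false) w + List.count (true, false) w) + 2 * c := by ring
  have e2 : (r + r + List.count (false, false) w + List.count (true, false) w) * c =
    c * (List.count (false, false) w + List.count (true, false) w) + 2 * (r * c) := by ring
  rw [e1, e2]
  omega

theorem sum_eq {A : Type*} [CommRing A] (k : ℕ)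
    (Y Z : Matrix (Fin (2 * k)) (Fin (2 * k)) A)
    (S : Finset (Multiset (List PfLetter)))
    (hS₁ : ∀ M ∈ S, PfIndex k M)
    (hS₂ : ∀ M, PfIndex k M → ∃! M', M' ∈ S ∧ Multiset.Rel wordEqCT M M') :
    ∑ M ∈ S,
      (-1 : A) ^ (∑ w ∈ M.toFinset,
          M.count w * (w.count ((false : Bool), (false : Bool))
            + w.count ((true : Bool), (false : Bool)) + 1)) *
        ∏ w ∈ M.toFinset, sigmaCoeff (2 * k) ((w.map (letterMat Y Z)).prod) (M.count w) =
    coeff k (Rs Y Z k) := by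
  rw [Rs, coeff_prod]
  refine Finset.sum_of_injOn phi ?_ ?_ ?_ ?_
  · intro M hM M' hM' e
    have hM := Finset.mem_coe.1 hM
    have hM' := Finset.mem_coe.1 hM'
    have i1 := (idx_iff k M).1 (hS₁ M hM)
    have i2 := (idx_iff k M').1 (hS₁ M' hM')
    have r := rel_of_map i1.1 i2.1 (phi_inj (hS₁ M hM) (hS₁ M' hM') e)
    have r0 := rel_of_map i1.1 i1.1 rfl
    exact (hS₂ M (hS₁ M hM)).unique ⟨hM, r0⟩ ⟨hM', r⟩
  · intro M hM
    exact Finset.mem_coe.2 (phi_mem (hS₁ M (Finset.mem_coe.1 hM)))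
  · intro l hl hn
    by_contra hne
    apply hn
    rw [Finset.mem_finsuppAntidiag] at hl
    have hdvd : ∀ u ∈ Us k, u.length / 2 ∣ l u := by
      intro u hu
      by_contra hnd
      apply hne
      apply Finset.prod_eq_zero hu
      have := psdet_coeff (u.length / 2) (isPB_pos ((mem_Us k u).1 hu).1) 1 (smw Y Z u) (l u)
      rw [one_smul, if_neg hnd] at this
      exact this
    set N : Multiset (List PfLetter) := ∑ u ∈ Us k, Multiset.replicate (l u / (u.length / 2)) u with hN
    have hc : ∀ u, N.count u = if u ∈ Us k then l u / (u.length / 2) else 0 := by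
      intro u
      rw [hN, Multiset.count_sum']
      simp [Multiset.count_replicate]
    have hmem : ∀ u ∈ N, u ∈ Us k := by
      intro u hu
      rw [← Multiset.count_ne_zero, hc] at hu
      by_contra h
      simp [h] at hu
    have hrep : N.map repw = N := by
      conv_rhs => rw [← Multiset.map_id N]
      exact Multiset.map_congr rfl fun u hu => ((mem_Us k u).1 (hmem u hu)).2.1
    have hpb : ∀ w ∈ N, isPB w := fun w hw => ((mem_Us k w).1 (hmem w hw)).1
    have hidx : PfIndex k N := by
      rw [idx_iff]
      refine ⟨hpb, ?_, ?_⟩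
      · intro w hw w' hw' h
        rw [← ((mem_Us k w).1 (hmem w hw)).2.1, ← ((mem_Us k w').1 (hmem w' hw')).2.1]
        exact repw_eq (hpb w hw) (hpb w' hw') h
      · change Multiset.sumAddMonoidHom (Multiset.mapAddMonoidHom (fun w : List PfLetter => w.length / 2) N) = k
        rw [hN, map_sum, map_sum]
        refine Eq.trans ?_ hl.1
        refine Finset.sum_congr rfl fun u hu => ?_
        rw [Multiset.coe_mapAddMonoidHom, Multiset.coe_sumAddMonoidHom, Multiset.map_replicate, Multiset.sum_replicate, smul_eq_mul, Nat.div_mul_cancel (hdvd u hu)]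
    obtain ⟨M, ⟨hM, hr⟩, _⟩ := hS₂ N hidx
    refine ⟨M, Finset.mem_coe.2 hM, ?_⟩
    have hmap := map_of_rel hpb ((idx_iff k M).1 (hS₁ M hM)).1 hr
    ext u
    rw [phi_apply, ← hmap, hrep, hc]
    split_ifs with hu
    · rw [Nat.mul_div_cancel' (hdvd u hu)]
    · rw [mul_zero]
      symm
      by_contra h
      exact hu (hl.2 (Finsupp.mem_support_iff.2 h))
  · intro M hM
    have hI := hS₁ M hM
    obtain ⟨h1, h2, h3⟩ := (idx_iff k M).1 hI
    have hinj : Set.InjOn repw {x | x ∈ M} := fun w hw w' hw' e => h2 w hw w' hw' (repw_inj (h1 w hw) (h1 w' hw') e)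
    have hs : (M.map repw).toFinset ⊆ Us k := fun u hu => map_rep_Us hI (Multiset.mem_toFinset.1 hu)
    rw [← Finset.prod_subset hs]
    · rw [← Finset.prod_pow_eq_pow_sum, ← Finset.prod_mul_distrib, Multiset.toFinset_map, Finset.prod_image]
      · refine Finset.prod_congr rfl fun w hw => ?_
        have hw' := Multiset.mem_toFinset.1 hw
        rw [phi_apply, Multiset.count_map_eq_count repw M hinj w hw', factor_eq Y Z (h1 w hw')]
        rw [Finset.sum_multiset_map_count] at h3
        have h5 := Finset.single_le_sum (f := fun w => M.count w • (w.length / 2)) (fun _ _ => Nat.zero_le _) hw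
        rw [h3] at h5
        have h6 := isPB_pos (h1 w hw')
        simp only [smul_eq_mul] at h5
        nlinarith
      · intro w hw w' hw'
        exact hinj (Multiset.mem_toFinset.1 hw) (Multiset.mem_toFinset.1 hw')
    · intro u hu hu'
      rw [Multiset.mem_toFinset] at hu'
      rw [phi_apply, Multiset.count_eq_zero_of_notMem hu', mul_zero, coeff_zero_eq_constantCoeff, psdet_const]
      exact isPB_pos ((mem_Us k u).1 hu).1
end PfW

theorem stmt7 {A : Type*} [CommRing A] (k : ℕ) (hk : 0 < k)
    (Y Z : Matrix (Fin (2 * k)) (Fin (2 * k)) A)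
    -- `S` is a set of representatives of the equivalence classes (up to cyclic
    -- permutation and reversal-with-transposition) of multisets satisfying `PfIndex`
    (S : Finset (Multiset (List PfLetter)))
    (hS₁ : ∀ M ∈ S, PfIndex k M)
    (hS₂ : ∀ M, PfIndex k M → ∃! M', M' ∈ S ∧ Multiset.Rel wordEqCT M M') :
    genPf Y * genPf Z = ∑ M ∈ S,
      (-1 : A) ^ (∑ w ∈ M.toFinset,
          M.count w * (w.count ((false : Bool), (false : Bool))
            + w.count ((true : Bool), (false : Bool)) + 1)) *
        ∏ w ∈ M.toFinset, sigmaCoeff (2 * k) ((w.map (letterMat Y Z)).prod) (M.count w) := by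
  rw [PfW.main_eq, PfW.sum_eq k Y Z S hS₁ hS₂]
end
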